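/- arXiv:2205.08586 — 10 statements merged into one kernel-verified Lean document; each statement's English description precedes it below -/
import Mathlib

section
/- Let (Z, 𝒜) be a measurable space, let μ₁ and μ₂ be probability measures on Z, let c > 0, and let g satisfy Assumption G. For a measurable rule δ : Z → [0,1] define R₁(δ) := ∫ g(c·(1 − δ(z))) dμ₁(z) and R₂(δ) := ∫ g(c·δ(z)) dμ₂(z). Then there exists a measurable rule δ̃ : Z → [0,1] such that: (i) δ̃ is not dominated on {μ₁, μ₂}, i.e. there is no measurable δ′ : Z → [0,1] with R₁(δ′) ≤ R₁(δ̃) and R₂(δ′) ≤ R₂(δ̃) with at least one inequality strict; (ii) for every measurable singleton rule δ with μ₁(δ = 1) = μ₂(δ = 1) = 1 there is k ∈ {1,2} with R_k(δ̃) ≠ R_k(δ); and (iii) for every measurable singleton rule δ with μ₁(δ = 1) = μ₂(δ = 1) = 0 there is k ∈ {1,2} with R_k(δ̃) ≠ R_k(δ). -/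
open MeasureTheory

/-- Assumption G: `g : ℝ⁺ → ℝ⁺` is continuously differentiable (with derivative `g'`),
strictly increasing on `[0,∞)`, and `g' 0 = 0`. -/
structure AssumptionG (g g' : ℝ → ℝ) : Prop where
  nonneg : ∀ x ∈ Set.Ici (0:ℝ), 0 ≤ g x
  hasDeriv : ∀ x ∈ Set.Ici (0:ℝ), HasDerivWithinAt g (g' x) (Set.Ici 0) x
  contDeriv : ContinuousOn g' (Set.Ici 0)
  strictMono : StrictMonoOn g (Set.Ici 0)
  deriv_zero : g' 0 = 0

/-- Risk under the state with treatment effect `c > 0` (regret of `δ` is `c·(1 − δ)`). -/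
noncomputable def riskPos {Z : Type*} [MeasurableSpace Z]
    (g : ℝ → ℝ) (μ : Measure Z) (c : ℝ) (δ : Z → ℝ) : ℝ :=
  ∫ z, g (c * (1 - δ z)) ∂μ

/-- Risk under the state with treatment effect `−c < 0` (regret of `δ` is `c·δ`). -/
noncomputable def riskNeg {Z : Type*} [MeasurableSpace Z]
    (g : ℝ → ℝ) (μ : Measure Z) (c : ℝ) (δ : Z → ℝ) : ℝ :=
  ∫ z, g (c * δ z) ∂μ

/-- A random variable bounded below by its mean is almost surely constant. -/
theorem ae_eq_const_of_integral_le {Z : Type*} [MeasurableSpace Z] {μ : Measure Z}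
    [IsProbabilityMeasure μ] {h : Z → ℝ} {a : ℝ} (hInt : Integrable h μ)
    (hle : ∀ᵐ z ∂μ, a ≤ h z) (hI : ∫ z, h z ∂μ ≤ a) : ∀ᵐ z ∂μ, h z = a := by
  have hInt' : Integrable (fun z => h z - a) μ := hInt.sub (integrable_const a)
  have hnn : 0 ≤ᵐ[μ] fun z => h z - a := by
    filter_upwards [hle] with z hz
    simpa using hz
  have h0 : ∫ z, (h z - a) ∂μ = 0 := by
    refine le_antisymm ?_ (integral_nonneg_of_ae hnn)
    rw [integral_sub hInt (integrable_const a)]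
    simpa using hI
  filter_upwards [(integral_eq_zero_iff_of_nonneg_ae hnn hInt').1 h0] with z hz
  simpa [sub_eq_zero] using hz

/-- A random variable bounded above by its mean is almost surely constant. -/
theorem ae_eq_const_of_le_integral {Z : Type*} [MeasurableSpace Z] {μ : Measure Z}
    [IsProbabilityMeasure μ] {h : Z → ℝ} {a : ℝ} (hInt : Integrable h μ)
    (hle : ∀ᵐ z ∂μ, h z ≤ a) (hI : a ≤ ∫ z, h z ∂μ) : ∀ᵐ z ∂μ, h z = a := by
  have := ae_eq_const_of_integral_le (h := fun z => -h z) (a := -a) hInt.neg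
    (hle.mono fun z hz => neg_le_neg hz) (by rw [integral_neg]; exact neg_le_neg hI)
  exact this.mono fun z hz => neg_injective hz

theorem one_sub_mem_Icc_zero_one {x : ℝ} (hx : x ∈ Set.Icc (0:ℝ) 1) :
    1 - x ∈ Set.Icc (0:ℝ) 1 :=
  ⟨by linarith [hx.2], by linarith [hx.1]⟩

section UnitLoss

variable {Z : Type*} [MeasurableSpace Z] {φ : ℝ → ℝ}

theorem StrictMonoOn.mem_Icc_of_mem_unit (hm : StrictMonoOn φ (Set.Icc 0 1)) {x : ℝ}
    (hx : x ∈ Set.Icc (0:ℝ) 1) : φ x ∈ Set.Icc (φ 0) (φ 1) :=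
  ⟨hm.monotoneOn ⟨le_rfl, zero_le_one⟩ hx hx.1, hm.monotoneOn hx ⟨zero_le_one, le_rfl⟩ hx.2⟩

theorem integrable_comp_of_unit (μ : Measure Z) [IsFiniteMeasure μ] (hφ : Continuous φ)
    (hm : StrictMonoOn φ (Set.Icc 0 1)) {d : Z → ℝ} (hd : Measurable d)
    (hd01 : ∀ z, d z ∈ Set.Icc (0:ℝ) 1) : Integrable (fun z => φ (d z)) μ :=
  Integrable.of_mem_Icc (φ 0) (φ 1) (hφ.measurable.comp hd).aemeasurable
    (.of_forall fun z => hm.mem_Icc_of_mem_unit (hd01 z))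

theorem ae_eq_zero_of_integral_comp_eq {μ : Measure Z} [IsProbabilityMeasure μ]
    (hφ : Continuous φ) (hm : StrictMonoOn φ (Set.Icc 0 1)) {d : Z → ℝ} (hd : Measurable d)
    (hd01 : ∀ z, d z ∈ Set.Icc (0:ℝ) 1) (h : ∫ z, φ (d z) ∂μ = φ 0) : ∀ᵐ z ∂μ, d z = 0 := by
  filter_upwards [ae_eq_const_of_integral_le (integrable_comp_of_unit μ hφ hm hd hd01)
    (.of_forall fun z => (hm.mem_Icc_of_mem_unit (hd01 z)).1) h.le] with z hz
  exact hm.injOn (hd01 z) ⟨le_rfl, zero_le_one⟩ hz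

theorem ae_eq_one_of_integral_comp_eq {μ : Measure Z} [IsProbabilityMeasure μ]
    (hφ : Continuous φ) (hm : StrictMonoOn φ (Set.Icc 0 1)) {d : Z → ℝ} (hd : Measurable d)
    (hd01 : ∀ z, d z ∈ Set.Icc (0:ℝ) 1) (h : ∫ z, φ (d z) ∂μ = φ 1) : ∀ᵐ z ∂μ, d z = 1 := by
  filter_upwards [ae_eq_const_of_le_integral (integrable_comp_of_unit μ hφ hm hd hd01)
    (.of_forall fun z => (hm.mem_Icc_of_mem_unit (hd01 z)).2) h.ge] with z hz
  exact hm.injOn (hd01 z) ⟨zero_le_one, le_rfl⟩ hz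

/-- The weighted two-state loss has a monotone selection of minimizers, as a function of the
weight on the first state. -/
theorem exists_monotone_argmin (hφ : Continuous φ) (hm : StrictMonoOn φ (Set.Icc 0 1)) :
    ∃ s : ℝ → ℝ, Monotone s ∧ ∀ t, s t ∈ Set.Icc (0:ℝ) 1 ∧
      ∀ d ∈ Set.Icc (0:ℝ) 1,
        t * φ (1 - s t) + (1 - t) * φ (s t) ≤ t * φ (1 - d) + (1 - t) * φ d := by
  have hex : ∀ t : ℝ, ∃ x ∈ Set.Icc (0:ℝ) 1, ∀ d ∈ Set.Icc (0:ℝ) 1,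
      t * φ (1 - x) + (1 - t) * φ x ≤ t * φ (1 - d) + (1 - t) * φ d := by
    intro t
    have hc : ContinuousOn (fun d => t * φ (1 - d) + (1 - t) * φ d) (Set.Icc (0:ℝ) 1) := by
      fun_prop
    obtain ⟨x, hx, hmin⟩ := isCompact_Icc.exists_isMinOn ⟨0, le_rfl, zero_le_one⟩ hc
    exact ⟨x, hx, fun d hd => hmin hd⟩
  choose s hs hmin using hex
  refine ⟨s, fun t t' htt => ?_, fun t => ⟨hs t, hmin t⟩⟩
  rcases htt.eq_or_lt with rfl | hlt
  · exact le_rfl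
  by_contra! hss
  have h1 := hmin t _ (hs t')
  have h2 := hmin t' _ (hs t)
  have h3 : φ (s t') < φ (s t) := hm (hs t') (hs t) hss
  have h4 : φ (1 - s t) < φ (1 - s t') :=
    hm (one_sub_mem_Icc_zero_one (hs t)) (one_sub_mem_Icc_zero_one (hs t')) (by linarith)
  nlinarith [mul_pos (sub_pos.2 hlt) (sub_pos.2 h3), mul_pos (sub_pos.2 hlt) (sub_pos.2 h4)]

/-- The unweighted Bayes problem has a solution whose risk profile differs from those of the two
constant rules, provided the two sampling distributions differ. -/
theorem exists_bayes_rule_of_ne {μ₁ μ₂ : Measure Z} [IsProbabilityMeasure μ₁]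
    [IsProbabilityMeasure μ₂] (hne : μ₁ ≠ μ₂) (hφ : Continuous φ)
    (hm : StrictMonoOn φ (Set.Icc 0 1)) :
    ∃ δt : Z → ℝ, Measurable δt ∧ (∀ z, δt z ∈ Set.Icc (0:ℝ) 1) ∧
      (∀ δ' : Z → ℝ, Measurable δ' → (∀ z, δ' z ∈ Set.Icc (0:ℝ) 1) →
        ∫ z, φ (1 - δt z) ∂μ₁ + ∫ z, φ (δt z) ∂μ₂ ≤
          ∫ z, φ (1 - δ' z) ∂μ₁ + ∫ z, φ (δ' z) ∂μ₂) ∧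
      ¬ (∫ z, φ (1 - δt z) ∂μ₁ = φ 0 ∧ ∫ z, φ (δt z) ∂μ₂ = φ 1) ∧
      ¬ (∫ z, φ (1 - δt z) ∂μ₁ = φ 1 ∧ ∫ z, φ (δt z) ∂μ₂ = φ 0) := by
  obtain ⟨s, hsm, hs⟩ := exists_monotone_argmin hφ hm
  have hφ01 : φ 0 < φ 1 := hm ⟨le_rfl, zero_le_one⟩ ⟨zero_le_one, le_rfl⟩ one_pos
  have hac₁ : μ₁ ≪ μ₁ + μ₂ := (Measure.le_add_right le_rfl).absolutelyContinuous
  have hac₂ : μ₂ ≪ μ₁ + μ₂ := (Measure.le_add_left le_rfl).absolutelyContinuous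
  set ν := μ₁ + μ₂ with hν
  set p : Z → ℝ := fun z => (μ₁.rnDeriv ν z).toReal with hp
  set q : Z → ℝ := fun z => (μ₂.rnDeriv ν z).toReal with hq
  have hpm : Measurable p := (Measure.measurable_rnDeriv _ _).ennreal_toReal
  have hpq : ∀ᵐ z ∂ν, q z = 1 - p z := by
    filter_upwards [Measure.rnDeriv_add' μ₁ μ₂ ν, Measure.rnDeriv_self ν,
      Measure.rnDeriv_lt_top μ₁ ν, Measure.rnDeriv_lt_top μ₂ ν] with z h1 h2 h3 h4
    have h5 : μ₁.rnDeriv ν z + μ₂.rnDeriv ν z = 1 := by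
      rw [← Pi.add_apply, ← h1, ← h2]
    have h6 := congrArg ENNReal.toReal h5
    rw [ENNReal.toReal_add h3.ne h4.ne, ENNReal.toReal_one] at h6
    simp only [hp, hq]
    linarith
  have hδm : Measurable fun z => s (p z) := hsm.measurable.comp hpm
  have hδ01 : ∀ z, s (p z) ∈ Set.Icc (0:ℝ) 1 := fun z => (hs (p z)).1
  have hae : ∀ {P : Z → Prop}, (∀ᵐ z ∂μ₁, P z) → (∀ᵐ z ∂μ₂, P z) → ∀ᵐ z ∂ν, P z :=
    fun h1 h2 => ae_add_measure_iff.2 ⟨h1, h2⟩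
  have hle_eq : ∀ {κ₁ κ₂ : Measure Z} [IsProbabilityMeasure κ₁] [IsProbabilityMeasure κ₂],
      κ₁ ≪ ν → κ₂ ≪ ν → (∀ᵐ z ∂ν, (κ₁.rnDeriv ν z).toReal ≤ (κ₂.rnDeriv ν z).toReal) →
      κ₁ = κ₂ := by
    intro κ₁ κ₂ _ _ h1 h2 h
    refine Measure.eq_of_le_of_isProbabilityMeasure ?_
    rw [← Measure.withDensity_rnDeriv_eq κ₁ ν h1, ← Measure.withDensity_rnDeriv_eq κ₂ ν h2]
    refine withDensity_mono ?_
    filter_upwards [h, Measure.rnDeriv_lt_top κ₁ ν, Measure.rnDeriv_lt_top κ₂ ν] with z hz a b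
    exact (ENNReal.toReal_le_toReal a.ne b.ne).1 hz
  refine ⟨fun z => s (p z), hδm, hδ01, ?_, ?_, ?_⟩
  · intro δ' hδ'm hδ'01
    have hInt₁ : ∀ d : Z → ℝ, Measurable d → (∀ z, d z ∈ Set.Icc (0:ℝ) 1) →
        Integrable (fun z => p z * φ (1 - d z)) ν := fun d hd hd1 =>
      (integrable_rnDeriv_smul_iff hac₁).2 (integrable_comp_of_unit μ₁ hφ hm
        (measurable_const.sub hd) fun z => one_sub_mem_Icc_zero_one (hd1 z))
    have hInt₂ : ∀ d : Z → ℝ, Measurable d → (∀ z, d z ∈ Set.Icc (0:ℝ) 1) →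
        Integrable (fun z => q z * φ (d z)) ν := fun d hd hd1 =>
      (integrable_rnDeriv_smul_iff hac₂).2 (integrable_comp_of_unit μ₂ hφ hm hd hd1)
    have hsum : ∀ d : Z → ℝ, Measurable d → (∀ z, d z ∈ Set.Icc (0:ℝ) 1) →
        ∫ z, φ (1 - d z) ∂μ₁ + ∫ z, φ (d z) ∂μ₂ =
          ∫ z, (p z * φ (1 - d z) + q z * φ (d z)) ∂ν := fun d hd hd1 => by
      rw [integral_add (hInt₁ d hd hd1) (hInt₂ d hd hd1)]
      exact congrArg₂ _ (integral_rnDeriv_smul hac₁).symm (integral_rnDeriv_smul hac₂).symm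
    rw [hsum _ hδm hδ01, hsum _ hδ'm hδ'01]
    refine integral_mono_ae ((hInt₁ _ hδm hδ01).add (hInt₂ _ hδm hδ01))
      ((hInt₁ _ hδ'm hδ'01).add (hInt₂ _ hδ'm hδ'01)) ?_
    filter_upwards [hpq] with z hz
    simp only [hz]
    exact (hs (p z)).2 _ (hδ'01 z)
  · rintro ⟨h1, h2⟩
    have h1' := ae_eq_zero_of_integral_comp_eq hφ hm (measurable_const.sub hδm)
      (fun z => one_sub_mem_Icc_zero_one (hδ01 z)) h1
    have h2' := ae_eq_one_of_integral_comp_eq hφ hm hδm hδ01 h2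
    refine hne (hle_eq hac₂ hac₁ ?_).symm
    filter_upwards [hae (h1'.mono fun z hz => (sub_eq_zero.1 hz).symm) h2', hpq] with z hz hzq
    have h := (hs (p z)).2 0 ⟨le_rfl, zero_le_one⟩
    rw [hz] at h
    simp only [sub_self, sub_zero] at h
    change q z ≤ p z
    nlinarith
  · rintro ⟨h1, h2⟩
    have h1' := ae_eq_one_of_integral_comp_eq hφ hm (measurable_const.sub hδm)
      (fun z => one_sub_mem_Icc_zero_one (hδ01 z)) h1
    have h2' := ae_eq_zero_of_integral_comp_eq hφ hm hδm hδ01 h2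
    refine hne (hle_eq hac₁ hac₂ ?_)
    filter_upwards [hae (h1'.mono fun z hz => sub_eq_self.1 hz) h2', hpq] with z hz hzq
    have h := (hs (p z)).2 1 ⟨zero_le_one, le_rfl⟩
    rw [hz] at h
    simp only [sub_self, sub_zero] at h
    change p z ≤ q z
    nlinarith

/-- When both states share a sampling distribution that splits `Z` nontrivially, the unweighted
Bayes problem has a solution whose risk profile differs from those of the two constant rules. -/
theorem exists_bayes_rule_of_split {μ : Measure Z} [IsProbabilityMeasure μ] {E : Set Z}
    (hE : MeasurableSet E) (hE0 : μ E ≠ 0) (hEc0 : μ Eᶜ ≠ 0) (hφ : Continuous φ)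
    (hm : StrictMonoOn φ (Set.Icc 0 1)) :
    ∃ δt : Z → ℝ, Measurable δt ∧ (∀ z, δt z ∈ Set.Icc (0:ℝ) 1) ∧
      (∀ δ' : Z → ℝ, Measurable δ' → (∀ z, δ' z ∈ Set.Icc (0:ℝ) 1) →
        ∫ z, φ (1 - δt z) ∂μ + ∫ z, φ (δt z) ∂μ ≤
          ∫ z, φ (1 - δ' z) ∂μ + ∫ z, φ (δ' z) ∂μ) ∧
      ¬ (∫ z, φ (1 - δt z) ∂μ = φ 0 ∧ ∫ z, φ (δt z) ∂μ = φ 1) ∧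
      ¬ (∫ z, φ (1 - δt z) ∂μ = φ 1 ∧ ∫ z, φ (δt z) ∂μ = φ 0) := by
  classical
  obtain ⟨s, -, hs⟩ := exists_monotone_argmin hφ hm
  obtain ⟨hm01, hmin⟩ := hs (1 / 2)
  set m := s (1 / 2)
  set δt : Z → ℝ := E.piecewise (fun _ => m) (fun _ => 1 - m) with hδt
  have hon : ∀ z ∈ E, δt z = m := fun z hz => Set.piecewise_eq_of_mem _ _ _ hz
  have hoff : ∀ z ∈ Eᶜ, δt z = 1 - m := fun z hz => Set.piecewise_eq_of_notMem _ _ _ hz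
  have hδm : Measurable δt := measurable_const.piecewise hE measurable_const
  have hδ01 : ∀ z, δt z ∈ Set.Icc (0:ℝ) 1 := fun z => by
    by_cases hz : z ∈ E
    · rw [hon z hz]; exact hm01
    · rw [hoff z hz]; exact one_sub_mem_Icc_zero_one hm01
  have hval : ∀ a : ℝ, (∀ᵐ z ∂μ, δt z = a) → m = a ∧ 1 - m = a := fun a ha => by
    obtain ⟨z, hz, hza⟩ := ((frequently_ae_mem_iff.2 hE0).and_eventually ha).exists
    obtain ⟨w, hw, hwa⟩ := ((frequently_ae_mem_iff.2 hEc0).and_eventually ha).exists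
    exact ⟨(hon z hz).symm.trans hza, (hoff w hw).symm.trans hwa⟩
  refine ⟨δt, hδm, hδ01, fun δ' hδ'm hδ'01 => ?_, ?_, ?_⟩
  · have hInt₁ : ∀ d : Z → ℝ, Measurable d → (∀ z, d z ∈ Set.Icc (0:ℝ) 1) →
        Integrable (fun z => φ (1 - d z)) μ := fun d hd hd1 =>
      integrable_comp_of_unit μ hφ hm (measurable_const.sub hd)
        fun z => one_sub_mem_Icc_zero_one (hd1 z)
    have hInt₂ : ∀ d : Z → ℝ, Measurable d → (∀ z, d z ∈ Set.Icc (0:ℝ) 1) →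
        Integrable (fun z => φ (d z)) μ := fun d hd hd1 =>
      integrable_comp_of_unit μ hφ hm hd hd1
    rw [← integral_add (hInt₁ _ hδm hδ01) (hInt₂ _ hδm hδ01),
      ← integral_add (hInt₁ _ hδ'm hδ'01) (hInt₂ _ hδ'm hδ'01)]
    refine integral_mono ((hInt₁ _ hδm hδ01).add (hInt₂ _ hδm hδ01))
      ((hInt₁ _ hδ'm hδ'01).add (hInt₂ _ hδ'm hδ'01)) fun z => ?_
    have h := hmin _ (hδ'01 z)
    by_cases hz : z ∈ E
    · simp only [hon z hz]; linarith
    · simp only [hoff z hz, sub_sub_cancel]; linarith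
  · rintro ⟨-, h⟩
    have := hval 1 (ae_eq_one_of_integral_comp_eq hφ hm hδm hδ01 h)
    linarith
  · rintro ⟨-, h⟩
    have := hval 0 (ae_eq_zero_of_integral_comp_eq hφ hm hδm hδ01 h)
    linarith

/-- For a zero-one valued sampling distribution, the constant rule `1 / 2` is undominated. -/
theorem half_not_dominated_of_trivial {μ : Measure Z} [IsProbabilityMeasure μ]
    (htriv : ∀ E, MeasurableSet E → μ E = 0 ∨ μ Eᶜ = 0) (hφ : Continuous φ)
    (hm : StrictMonoOn φ (Set.Icc 0 1)) {δ' : Z → ℝ} (hδ'm : Measurable δ')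
    (hδ'01 : ∀ z, δ' z ∈ Set.Icc (0:ℝ) 1) (h1 : ∫ z, φ (1 - δ' z) ∂μ ≤ φ (1 / 2))
    (h2 : ∫ z, φ (δ' z) ∂μ ≤ φ (1 / 2)) :
    ∫ z, φ (1 - δ' z) ∂μ = φ (1 / 2) ∧ ∫ z, φ (δ' z) ∂μ = φ (1 / 2) := by
  have hhalf : (1 / 2 : ℝ) ∈ Set.Icc (0:ℝ) 1 := by norm_num
  have hae : ∀ᵐ z ∂μ, δ' z = 1 / 2 := by
    rcases htriv {z | δ' z ≤ 1 / 2} (measurableSet_le hδ'm measurable_const) with h | h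
    · have hgt : ∀ᵐ z ∂μ, ¬ δ' z ≤ 1 / 2 := by simpa [ae_iff] using h
      filter_upwards [ae_eq_const_of_integral_le (integrable_comp_of_unit μ hφ hm hδ'm hδ'01)
        (hgt.mono fun z hz => hm.monotoneOn hhalf (hδ'01 z) (not_le.1 hz).le) h2] with z hz
      exact hm.injOn (hδ'01 z) hhalf hz
    · have hle : ∀ᵐ z ∂μ, δ' z ≤ 1 / 2 := h
      have h01 : ∀ z, 1 - δ' z ∈ Set.Icc (0:ℝ) 1 := fun z => one_sub_mem_Icc_zero_one (hδ'01 z)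
      filter_upwards [ae_eq_const_of_integral_le (h := fun z => φ (1 - δ' z))
        (integrable_comp_of_unit μ hφ hm (measurable_const.sub hδ'm) h01)
        (hle.mono fun z hz => hm.monotoneOn hhalf (h01 z) (by linarith)) h1] with z hz
      linarith [hm.injOn (h01 z) hhalf hz]
  have e1 : ∫ z, φ (1 - δ' z) ∂μ = ∫ _, φ (1 / 2) ∂μ :=
    integral_congr_ae (hae.mono fun z hz => by norm_num [hz])
  have e2 : ∫ z, φ (δ' z) ∂μ = ∫ _, φ (1 / 2) ∂μ :=
    integral_congr_ae (hae.mono fun z hz => by simp only [hz])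
  exact ⟨by simpa using e1, by simpa using e2⟩

theorem exists_undominated_rule (μ₁ μ₂ : Measure Z) [IsProbabilityMeasure μ₁]
    [IsProbabilityMeasure μ₂] (hφ : Continuous φ) (hm : StrictMonoOn φ (Set.Icc 0 1)) :
    ∃ δt : Z → ℝ, Measurable δt ∧ (∀ z, δt z ∈ Set.Icc (0:ℝ) 1) ∧
      (∀ δ' : Z → ℝ, Measurable δ' → (∀ z, δ' z ∈ Set.Icc (0:ℝ) 1) →
        ∫ z, φ (1 - δ' z) ∂μ₁ ≤ ∫ z, φ (1 - δt z) ∂μ₁ →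
        ∫ z, φ (δ' z) ∂μ₂ ≤ ∫ z, φ (δt z) ∂μ₂ →
        ∫ z, φ (1 - δ' z) ∂μ₁ = ∫ z, φ (1 - δt z) ∂μ₁ ∧
          ∫ z, φ (δ' z) ∂μ₂ = ∫ z, φ (δt z) ∂μ₂) ∧
      ¬ (∫ z, φ (1 - δt z) ∂μ₁ = φ 0 ∧ ∫ z, φ (δt z) ∂μ₂ = φ 1) ∧
      ¬ (∫ z, φ (1 - δt z) ∂μ₁ = φ 1 ∧ ∫ z, φ (δt z) ∂μ₂ = φ 0) := by
  by_cases hne : μ₁ = μ₂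
  · subst hne
    by_cases hsplit : ∃ E, MeasurableSet E ∧ μ₁ E ≠ 0 ∧ μ₁ Eᶜ ≠ 0
    · obtain ⟨E, hE, hE0, hEc0⟩ := hsplit
      obtain ⟨δt, h1, h2, h3, h4⟩ := exists_bayes_rule_of_split hE hE0 hEc0 hφ hm
      refine ⟨δt, h1, h2, fun δ' a b u v => ?_, h4⟩
      have := h3 δ' a b
      constructor <;> linarith
    · have htriv : ∀ E, MeasurableSet E → μ₁ E = 0 ∨ μ₁ Eᶜ = 0 := fun E hE => by
        by_contra! h
        exact hsplit ⟨E, hE, h.1, h.2⟩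
      have hhalf : (1 / 2 : ℝ) ∈ Set.Icc (0:ℝ) 1 := by norm_num
      have hlt : φ (1 / 2) < φ 1 := hm hhalf ⟨zero_le_one, le_rfl⟩ (by norm_num)
      have e : ∫ _, φ (1 - 1 / 2) ∂μ₁ = φ (1 / 2) := by norm_num
      have e' : ∫ _, φ (1 / 2) ∂μ₁ = φ (1 / 2) := by simp
      refine ⟨fun _ => 1 / 2, measurable_const, fun _ => hhalf, fun δ' a b u v => ?_, ?_, ?_⟩
      · rw [e] at u ⊢
        rw [e'] at v ⊢
        exact half_not_dominated_of_trivial htriv hφ hm a b u v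
      · rintro ⟨-, h⟩
        exact hlt.ne (e'.symm.trans h)
      · rintro ⟨h, -⟩
        exact hlt.ne (e.symm.trans h)
  · obtain ⟨δt, h1, h2, h3, h4⟩ := exists_bayes_rule_of_ne hne hφ hm
    refine ⟨δt, h1, h2, fun δ' a b u v => ?_, h4⟩
    have := h3 δ' a b
    constructor <;> linarith

end UnitLoss

theorem stmt2 {Z : Type*} [MeasurableSpace Z]
    (μ₁ μ₂ : Measure Z) [IsProbabilityMeasure μ₁] [IsProbabilityMeasure μ₂]
    (c : ℝ) (hc : 0 < c) (g g' : ℝ → ℝ) (hg : AssumptionG g g') :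
    ∃ δt : Z → ℝ, Measurable δt ∧ (∀ z, δt z ∈ Set.Icc (0:ℝ) 1) ∧
      -- (i) δ̃ is not dominated on {μ₁, μ₂}
      (¬ ∃ δ' : Z → ℝ, Measurable δ' ∧ (∀ z, δ' z ∈ Set.Icc (0:ℝ) 1) ∧
          riskPos g μ₁ c δ' ≤ riskPos g μ₁ c δt ∧
          riskNeg g μ₂ c δ' ≤ riskNeg g μ₂ c δt ∧
          (riskPos g μ₁ c δ' < riskPos g μ₁ c δt ∨
            riskNeg g μ₂ c δ' < riskNeg g μ₂ c δt)) ∧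
      -- (ii) δ̃ has a different risk profile from every singleton rule treating everyone a.s.
      (∀ δ : Z → ℝ, Measurable δ → (∀ z, δ z = 0 ∨ δ z = 1) →
        μ₁ {z | δ z = 1} = 1 → μ₂ {z | δ z = 1} = 1 →
        (riskPos g μ₁ c δt ≠ riskPos g μ₁ c δ ∨
          riskNeg g μ₂ c δt ≠ riskNeg g μ₂ c δ)) ∧
      -- (iii) δ̃ has a different risk profile from every singleton rule treating no one a.s.
      (∀ δ : Z → ℝ, Measurable δ → (∀ z, δ z = 0 ∨ δ z = 1) →
        μ₁ {z | δ z = 1} = 0 → μ₂ {z | δ z = 1} = 0 →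
        (riskPos g μ₁ c δt ≠ riskPos g μ₁ c δ ∨
          riskNeg g μ₂ c δt ≠ riskNeg g μ₂ c δ)) := by
  set φ : ℝ → ℝ := fun x => g (c * max 0 (min x 1)) with hφdef
  have hφeq : ∀ x ∈ Set.Icc (0:ℝ) 1, φ x = g (c * x) := fun x hx => by
    simp only [hφdef, min_eq_left hx.2, max_eq_right hx.1]
  have hφ : Continuous φ := by
    have hgc : ContinuousOn g (Set.Ici 0) := fun x hx => (hg.hasDeriv x hx).continuousWithinAt
    exact hgc.comp_continuous (by fun_prop)
      fun x => Set.mem_Ici.2 (mul_nonneg hc.le (le_max_left _ _))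
  have hm : StrictMonoOn φ (Set.Icc 0 1) := fun x hx y hy hxy => by
    rw [hφeq x hx, hφeq y hy]
    exact hg.strictMono (mul_nonneg hc.le hx.1) (mul_nonneg hc.le hy.1)
      (mul_lt_mul_of_pos_left hxy hc)
  have hpos : ∀ δ : Z → ℝ, (∀ z, δ z ∈ Set.Icc (0:ℝ) 1) →
      riskPos g μ₁ c δ = ∫ z, φ (1 - δ z) ∂μ₁ := fun δ hδ =>
    integral_congr_ae (.of_forall fun z => (hφeq _ (one_sub_mem_Icc_zero_one (hδ z))).symm)
  have hneg : ∀ δ : Z → ℝ, (∀ z, δ z ∈ Set.Icc (0:ℝ) 1) →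
      riskNeg g μ₂ c δ = ∫ z, φ (δ z) ∂μ₂ := fun δ hδ =>
    integral_congr_ae (.of_forall fun z => (hφeq _ (hδ z)).symm)
  have hsing : ∀ δ : Z → ℝ, (∀ z, δ z = 0 ∨ δ z = 1) → ∀ z, δ z ∈ Set.Icc (0:ℝ) 1 :=
    fun δ hδ z => by rcases hδ z with h | h <;> simp [h]
  have hconst : ∀ (μ : Measure Z) [IsProbabilityMeasure μ] (ψ : ℝ → ℝ) (δ : Z → ℝ) (a : ℝ),
      (∀ᵐ z ∂μ, δ z = a) → ∫ z, ψ (δ z) ∂μ = ψ a := fun μ _ ψ δ a h => by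
    have e : ∫ z, ψ (δ z) ∂μ = ∫ _, ψ a ∂μ :=
      integral_congr_ae (h.mono fun z hz => congrArg ψ hz)
    simpa using e
  have hone : ∀ (μ : Measure Z) [IsProbabilityMeasure μ] (δ : Z → ℝ), Measurable δ →
      μ {z | δ z = 1} = 1 → ∀ᵐ z ∂μ, δ z = 1 := fun μ _ δ hδ h =>
    (mem_ae_iff_prob_eq_one (hδ (measurableSet_singleton 1))).2 h
  have hzero : ∀ (μ : Measure Z) (δ : Z → ℝ), (∀ z, δ z = 0 ∨ δ z = 1) →
      μ {z | δ z = 1} = 0 → ∀ᵐ z ∂μ, δ z = 0 := fun μ δ hδ h => by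
    have h' : ∀ᵐ z ∂μ, ¬ δ z = 1 := by simpa [ae_iff] using h
    exact h'.mono fun z hz => (hδ z).resolve_right hz
  obtain ⟨δt, hδm, hδ01, hund, hA, hB⟩ := exists_undominated_rule μ₁ μ₂ hφ hm
  refine ⟨δt, hδm, hδ01, ?_, ?_, ?_⟩
  · rintro ⟨δ', hm', h01', h⟩
    rw [hpos δ' h01', hneg δ' h01', hpos δt hδ01, hneg δt hδ01] at h
    obtain ⟨e1, e2⟩ := hund δ' hm' h01' h.1 h.2.1
    exact h.2.2.elim (fun l => l.ne e1) (fun l => l.ne e2)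
  · intro δ hd hs h1 h2
    rw [hpos δ (hsing δ hs), hneg δ (hsing δ hs), hpos δt hδ01, hneg δt hδ01,
      hconst μ₁ (fun x => φ (1 - x)) δ 1 (hone μ₁ δ hd h1), hconst μ₂ φ δ 1 (hone μ₂ δ hd h2),
      sub_self]
    exact not_and_or.1 hA
  · intro δ hd hs h1 h2
    rw [hpos δ (hsing δ hs), hneg δ (hsing δ hs), hpos δt hδ01, hneg δt hδ01,
      hconst μ₁ (fun x => φ (1 - x)) δ 0 (hzero μ₁ δ hs h1), hconst μ₂ φ δ 0 (hzero μ₂ δ hs h2),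
      sub_zero]
    exact not_and_or.1 hB
end

section
/- Let g(x) = k·x^α for constants k > 0 and α > 1. Let τ̄ > 0 and suppose that for each τ ∈ [−τ̄, τ̄] the function x ↦ f(x|τ) := A(τ)·exp(x·τ)·h(x) is a probability density on ℝ with respect to Lebesgue measure, where h : ℝ → [0,∞) is measurable and A(τ) > 0. Let t ∈ ℝ be an interior point of the support of the family, in the sense that ∫_{(−∞,t)} exp(x·τ̄)·h(x) dx > 0 and ∫_{(t,∞)} exp(−x·τ̄)·h(x) dx > 0. For a measurable rule δ : ℝ → [0,1], define R_g(δ, τ) := ∫ g(τ·(𝟙{τ ≥ 0} − δ(x)))·f(x|τ) dx. Then the singleton threshold rule δ_t(x) := 𝟙{x ≥ t} is inadmissible on [−τ̄, τ̄]: there exists λ ∈ (0,1) such that the fractional rule δ_{t,λ} := (1 − λ)·δ_t + λ·(1 − δ_t) satisfies R_g(δ_{t,λ}, τ) ≤ R_g(δ_t, τ) for all τ ∈ [−τ̄, τ̄], with strict inequality whenever τ ≠ 0. -/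
open MeasureTheory

/-- One-parameter exponential family density `f(x|τ) = A(τ)·exp(x·τ)·h(x)`. -/
noncomputable def expFam (A h : ℝ → ℝ) (x τ : ℝ) : ℝ :=
  A τ * Real.exp (x * τ) * h x

/-- Nonlinear regret risk of rule `δ` at state `τ` for the transformation
`g(x) = k·x^α`, under the sampling density `f(·|τ)` w.r.t. Lebesgue measure. -/
noncomputable def RgPow (k α : ℝ) (A h : ℝ → ℝ) (δ : ℝ → ℝ) (τ : ℝ) : ℝ :=
  ∫ x, k * (τ * ((if 0 ≤ τ then (1:ℝ) else 0) - δ x)) ^ α * expFam A h x τ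

/-- The singleton threshold rule `δ_t(x) = 𝟙{x ≥ t}`. -/
noncomputable def threshRule (t x : ℝ) : ℝ := if t ≤ x then 1 else 0

/-- Mixing a 0-1 loss `𝟙_S` with its complement strictly lowers the integrated power loss, once the
mixing weight is small relative to the masses of `S` and `Sᶜ`. -/
theorem integral_rpow_mix_lt {k α a l : ℝ} (hk : 0 < k) (hα : 1 < α) (ha : 0 < a)
    (hl : l ∈ Set.Ioo (0 : ℝ) 1) {w ρ : ℝ → ℝ} (hw : Integrable w) (hw0 : ∀ x, 0 ≤ w x)
    {S : Set ℝ} (hS : MeasurableSet S) (hρ : ∀ x ∈ S, ρ x = 1) (hρ' : ∀ x ∈ Sᶜ, ρ x = 0)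
    (hlt : l ^ (α - 1) * ∫ x in Sᶜ, w x < ∫ x in S, w x) :
    ∫ x, k * (a * ((1 - l) * ρ x + l * (1 - ρ x))) ^ α * w x
      < ∫ x, k * (a * ρ x) ^ α * w x := by
  obtain ⟨hl0, hl1⟩ := hl
  have hα0 : α ≠ 0 := by linarith
  have hmix : (fun x => k * (a * ((1 - l) * ρ x + l * (1 - ρ x))) ^ α * w x) =
      fun x => k * a ^ α * (1 - l) ^ α * S.indicator w x
        + k * a ^ α * l ^ α * Sᶜ.indicator w x := by
    funext x
    by_cases hx : x ∈ S
    · simp [hx, hρ x hx, Real.mul_rpow ha.le (sub_nonneg.2 hl1.le), mul_assoc]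
    · simp [hx, hρ' x hx, Real.mul_rpow ha.le hl0.le, mul_assoc]
  have hpure : (fun x => k * (a * ρ x) ^ α * w x) =
      fun x => k * a ^ α * S.indicator w x := by
    funext x
    by_cases hx : x ∈ S
    · simp [hx, hρ x hx]
    · simp [hx, hρ' x hx, Real.zero_rpow hα0]
  rw [hmix, hpure, integral_add ((hw.indicator hS).const_mul _)
    ((hw.indicator hS.compl).const_mul _), integral_const_mul, integral_const_mul,
    integral_const_mul, integral_indicator hS, integral_indicator hS.compl]
  have hL0 : 0 ≤ ∫ x in S, w x := integral_nonneg hw0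
  have hpow : (1 - l) ^ α ≤ 1 - l := by
    simpa using Real.rpow_le_rpow_of_exponent_ge (sub_pos.2 hl1) (by linarith) hα.le
  have hsplit : l ^ α = l * l ^ (α - 1) := by
    rw [← Real.rpow_one_add' hl0.le (by linarith)]
    ring_nf
  have hC : 0 < k * a ^ α := mul_pos hk (Real.rpow_pos_of_pos ha α)
  have hsum : (1 - l) ^ α * (∫ x in S, w x) + l ^ α * (∫ x in Sᶜ, w x) < ∫ x in S, w x := by
    rw [hsplit]
    nlinarith [mul_le_mul_of_nonneg_right hpow hL0, mul_lt_mul_of_pos_left hlt hl0]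
  nlinarith [mul_lt_mul_of_pos_left hsum hC]

/-- Moving the natural parameter from `σ` to `τ` preserves a strict mass comparison between `S` and
`Sᶜ` when the likelihood ratio is at least its value at `t` on `S` and at most that on `Sᶜ`. -/
theorem setIntegral_exp_tilt_lt {h : ℝ → ℝ} (hh0 : ∀ x, 0 ≤ h x) {c t σ τ : ℝ} (hc : 0 ≤ c)
    (hσ : Integrable fun x => Real.exp (x * σ) * h x)
    (hτ : Integrable fun x => Real.exp (x * τ) * h x) {S : Set ℝ} (hS : MeasurableSet S)
    (hin : ∀ x ∈ S, 0 ≤ (x - t) * (τ - σ)) (hout : ∀ x ∈ Sᶜ, (x - t) * (τ - σ) ≤ 0)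
    (hlt : c * ∫ x in Sᶜ, Real.exp (x * σ) * h x < ∫ x in S, Real.exp (x * σ) * h x) :
    c * ∫ x in Sᶜ, Real.exp (x * τ) * h x < ∫ x in S, Real.exp (x * τ) * h x := by
  have hlower : Real.exp (t * (τ - σ)) * ∫ x in S, Real.exp (x * σ) * h x
      ≤ ∫ x in S, Real.exp (x * τ) * h x := by
    rw [← integral_const_mul]
    refine setIntegral_mono_on (hσ.const_mul _).integrableOn hτ.integrableOn hS fun x hx => ?_
    rw [← mul_assoc, ← Real.exp_add]
    exact mul_le_mul_of_nonneg_right (Real.exp_le_exp.2 (by linarith [hin x hx])) (hh0 x)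
  have hupper : ∫ x in Sᶜ, Real.exp (x * τ) * h x
      ≤ Real.exp (t * (τ - σ)) * ∫ x in Sᶜ, Real.exp (x * σ) * h x := by
    rw [← integral_const_mul]
    refine setIntegral_mono_on hτ.integrableOn (hσ.const_mul _).integrableOn hS.compl
      fun x hx => ?_
    rw [← mul_assoc, ← Real.exp_add]
    exact mul_le_mul_of_nonneg_right (Real.exp_le_exp.2 (by linarith [hout x hx])) (hh0 x)
  nlinarith [mul_le_mul_of_nonneg_left hupper hc,
    mul_lt_mul_of_pos_left hlt (Real.exp_pos (t * (τ - σ)))]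

theorem exists_rpow_mul_lt {p B₁ C₁ B₂ C₂ : ℝ} (hp : 0 < p) (hC₁ : 0 < C₁) (hC₂ : 0 < C₂) :
    ∃ l ∈ Set.Ioo (0 : ℝ) 1, l ^ p * B₁ < C₁ ∧ l ^ p * B₂ < C₂ := by
  have hlim (B : ℝ) : Filter.Tendsto (fun l : ℝ => l ^ p * B) (nhdsWithin 0 (Set.Ioi 0))
      (nhds 0) := by
    have hcont : Continuous fun l : ℝ => l ^ p * B :=
      (Real.continuous_rpow_const hp.le).mul continuous_const
    have h0 := hcont.tendsto 0
    rw [Real.zero_rpow hp.ne', zero_mul] at h0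
    exact h0.mono_left nhdsWithin_le_nhds
  obtain ⟨l, hl, h₁, h₂⟩ := (Filter.eventually_mem_set.2 (Ioo_mem_nhdsGT one_pos) |>.and
    (((hlim B₁).eventually_lt_const hC₁).and ((hlim B₂).eventually_lt_const hC₂))).exists
  exact ⟨l, hl, h₁, h₂⟩

theorem stmt3 (k α τbar : ℝ) (hk : 0 < k) (hα : 1 < α) (hτbar : 0 < τbar)
    (A h : ℝ → ℝ) (hhmeas : Measurable h) (hh0 : ∀ x, 0 ≤ h x)
    (hA : ∀ τ ∈ Set.Icc (-τbar) τbar, 0 < A τ)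
    (hdens : ∀ τ ∈ Set.Icc (-τbar) τbar, ∫ x, expFam A h x τ = 1)
    (t : ℝ)
    (hlow : 0 < ∫ x in Set.Iio t, Real.exp (x * τbar) * h x)
    (hhigh : 0 < ∫ x in Set.Ioi t, Real.exp (-(x * τbar)) * h x) :
    ∃ l ∈ Set.Ioo (0:ℝ) 1,
      (∀ τ ∈ Set.Icc (-τbar) τbar,
        RgPow k α A h (fun x => (1 - l) * threshRule t x + l * (1 - threshRule t x)) τ
          ≤ RgPow k α A h (threshRule t) τ)
      ∧ ∀ τ ∈ Set.Icc (-τbar) τbar, τ ≠ 0 →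
        RgPow k α A h (fun x => (1 - l) * threshRule t x + l * (1 - threshRule t x)) τ
          < RgPow k α A h (threshRule t) τ := by
  have hexp (τ : ℝ) (hτ : τ ∈ Set.Icc (-τbar) τbar) :
      Integrable fun x => expFam A h x τ := by
    refine Integrable.of_integral_ne_zero ?_
    rw [hdens τ hτ]
    exact one_ne_zero
  have hint (τ : ℝ) (hτ : τ ∈ Set.Icc (-τbar) τbar) :
      Integrable fun x => Real.exp (x * τ) * h x := by
    refine ((hexp τ hτ).const_mul (A τ)⁻¹).congr (Filter.Eventually.of_forall fun x => ?_)
    simp only [expFam]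
    field_simp [(hA τ hτ).ne']
  have hpos : τbar ∈ Set.Icc (-τbar) τbar := ⟨by linarith, le_rfl⟩
  have hneg : -τbar ∈ Set.Icc (-τbar) τbar := ⟨le_rfl, by linarith⟩
  have hhigh' : 0 < ∫ x in Set.Ici t, Real.exp (x * -τbar) * h x := by
    simpa only [integral_Ici_eq_integral_Ioi, mul_neg] using hhigh
  obtain ⟨l, hl, hl₁, hl₂⟩ := exists_rpow_mul_lt
    (B₁ := ∫ x in (Set.Iio t)ᶜ, Real.exp (x * τbar) * h x)
    (B₂ := ∫ x in (Set.Ici t)ᶜ, Real.exp (x * -τbar) * h x) (sub_pos.2 hα) hlow hhigh'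
  have hc : 0 ≤ l ^ (α - 1) := Real.rpow_nonneg hl.1.le _
  have hscale (τ : ℝ) (hτ : τ ∈ Set.Icc (-τbar) τbar) (S : Set ℝ)
      (hlt : l ^ (α - 1) * ∫ x in Sᶜ, Real.exp (x * τ) * h x
        < ∫ x in S, Real.exp (x * τ) * h x) :
      l ^ (α - 1) * ∫ x in Sᶜ, expFam A h x τ < ∫ x in S, expFam A h x τ := by
    simp only [expFam, mul_assoc, integral_const_mul]
    nlinarith [mul_lt_mul_of_pos_left hlt (hA τ hτ)]
  have hstrict : ∀ τ ∈ Set.Icc (-τbar) τbar, τ ≠ 0 →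
      RgPow k α A h (fun x => (1 - l) * threshRule t x + l * (1 - threshRule t x)) τ
        < RgPow k α A h (threshRule t) τ := by
    intro τ hτ hτ0
    have hw0 (x : ℝ) : 0 ≤ expFam A h x τ :=
      mul_nonneg (mul_nonneg (hA τ hτ).le (Real.exp_pos _).le) (hh0 x)
    rcases lt_or_gt_of_ne hτ0 with hlt | hgt
    · have hmass := hscale τ hτ _ <| setIntegral_exp_tilt_lt (t := t) hh0 hc (hint _ hneg)
        (hint τ hτ) measurableSet_Ici
        (fun x hx => mul_nonneg (sub_nonneg.2 hx) (by linarith [hτ.1]))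
        (fun x hx => mul_nonpos_of_nonpos_of_nonneg
          (sub_nonpos.2 (Set.notMem_Ici.1 hx).le) (by linarith [hτ.1])) hl₂
      convert integral_rpow_mix_lt (ρ := threshRule t) hk hα (neg_pos.2 hlt) hl (hexp τ hτ) hw0
        measurableSet_Ici (fun x hx => if_pos hx) (fun x hx => if_neg hx) hmass using 1
      all_goals
        simp only [RgPow, if_neg (not_le.2 hlt)]
        ring_nf
    · have hmass := hscale τ hτ _ <| setIntegral_exp_tilt_lt (t := t) hh0 hc (hint _ hpos)
        (hint τ hτ) measurableSet_Iio
        (fun x hx => mul_nonneg_of_nonpos_of_nonpos (sub_nonpos.2 (le_of_lt hx))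
          (by linarith [hτ.2]))
        (fun x hx => mul_nonpos_of_nonneg_of_nonpos
          (sub_nonneg.2 (Set.notMem_Iio.1 hx)) (by linarith [hτ.2])) hl₁
      convert integral_rpow_mix_lt (ρ := fun x => 1 - threshRule t x) hk hα hgt hl (hexp τ hτ)
        hw0 measurableSet_Iio (fun x hx => by simp [threshRule, not_le.2 (Set.mem_Iio.1 hx)])
        (fun x hx => by simp [threshRule, Set.notMem_Iio.1 hx]) hmass using 1
      all_goals
        simp only [RgPow, if_pos hgt.le] <;> ring_nf
  refine ⟨l, hl, fun τ hτ => ?_, hstrict⟩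
  by_cases hτ0 : τ = 0
  · simp [RgPow, hτ0]
  · exact (hstrict τ hτ hτ0).le
end

section
/- Let φ and Φ denote the density and cumulative distribution function of the standard normal distribution, and define Ψ(x) := φ(x) / (Φ(x)·(1 + x²)), which is strictly positive for every x ∈ ℝ. Then for every ȳ ∈ ℝ, (∫_{[0,∞)} τ²·φ(τ − ȳ) dτ) / (∫_ℝ τ²·φ(τ − ȳ) dτ) = Φ(ȳ)·(1 + ȳ·Ψ(ȳ)). -/
open MeasureTheory

/-- The standard normal density `φ`. -/
noncomputable def stdPdf (x : ℝ) : ℝ := Real.exp (-x ^ 2 / 2) / Real.sqrt (2 * Real.pi)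

/-- The standard normal cumulative distribution function `Φ`. -/
noncomputable def stdCdf (x : ℝ) : ℝ := ∫ t in Set.Iic x, stdPdf t

/-- `Ψ(x) = φ(x) / (Φ(x)·(1 + x²))`. -/
noncomputable def Psi (x : ℝ) : ℝ := stdPdf x / (stdCdf x * (1 + x ^ 2))

lemma stdPdf_eq_gaussianPDFReal : stdPdf = ProbabilityTheory.gaussianPDFReal 0 1 := by
  ext x
  simp [stdPdf, ProbabilityTheory.gaussianPDFReal, div_eq_inv_mul]

lemma stdPdf_pos (x : ℝ) : 0 < stdPdf x := by
  unfold stdPdf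
  positivity

lemma stdPdf_neg (x : ℝ) : stdPdf (-x) = stdPdf x := by
  simp [stdPdf]

lemma hasDerivAt_stdPdf (x : ℝ) : HasDerivAt stdPdf (-x * stdPdf x) x := by
  have h : HasDerivAt (fun t : ℝ => -t ^ 2 / 2) (-x) x := by
    convert! ((hasDerivAt_pow 2 x).neg.div_const 2) using 1
    simp
    ring
  convert! (h.exp.div_const (Real.sqrt (2 * Real.pi))) using 1
  unfold stdPdf
  ring

lemma integrable_pow_mul_stdPdf (n : ℕ) : Integrable fun x : ℝ => x ^ n * stdPdf x := by
  have h := (integrable_rpow_mul_exp_neg_mul_sq (b := 1 / 2) (by norm_num) (s := n)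
    (by have : (0 : ℝ) ≤ n := n.cast_nonneg
        linarith)).div_const (Real.sqrt (2 * Real.pi))
  refine h.congr (ae_of_all _ fun x => ?_)
  simp only [stdPdf, Real.rpow_natCast]
  rw [mul_div_assoc]
  congr 3
  ring

lemma integrable_stdPdf : Integrable stdPdf := by
  simpa using integrable_pow_mul_stdPdf 0

lemma integral_stdPdf : ∫ x, stdPdf x = 1 := by
  rw [stdPdf_eq_gaussianPDFReal]
  exact ProbabilityTheory.integral_gaussianPDFReal_eq_one 0 one_ne_zero

lemma stdCdf_pos (x : ℝ) : 0 < stdCdf x := by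
  unfold stdCdf
  rw [setIntegral_pos_iff_support_of_nonneg_ae (ae_of_all _ fun t => (stdPdf_pos t).le)
    integrable_stdPdf.integrableOn]
  have : Function.support stdPdf = Set.univ :=
    Set.eq_univ_of_forall fun t => (stdPdf_pos t).ne'
  simp [this]

lemma setIntegral_Ioi_stdPdf_sub (y : ℝ) :
    ∫ τ in Set.Ioi (0 : ℝ), stdPdf (τ - y) = stdCdf y := by
  rw [stdCdf, ← integral_Ici_eq_integral_Ioi, ← integral_indicator measurableSet_Ici,
    ← integral_indicator measurableSet_Iic, ← integral_sub_left_eq_self ((Set.Iic y).indicator stdPdf) volume y]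
  congr 1 with τ
  have h : stdPdf (τ - y) = stdPdf (y - τ) := by rw [← stdPdf_neg, neg_sub]
  simp [Set.indicator, h]

lemma integrable_stdPdf_sub (y : ℝ) : Integrable fun τ : ℝ => stdPdf (τ - y) :=
  integrable_stdPdf.comp_sub_right y

lemma integrable_sq_mul_stdPdf_sub (y : ℝ) :
    Integrable fun τ : ℝ => τ ^ 2 * stdPdf (τ - y) := by
  have h := (((integrable_pow_mul_stdPdf 2).add
    ((integrable_pow_mul_stdPdf 1).const_mul (2 * y))).add
    (integrable_stdPdf.const_mul (y ^ 2))).comp_sub_right y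
  refine h.congr (ae_of_all _ fun τ => ?_)
  simp only [Pi.add_apply]
  ring

lemma integrable_add_mul_stdPdf_sub (y : ℝ) :
    Integrable fun τ : ℝ => -(τ + y) * stdPdf (τ - y) := by
  have h := (((integrable_pow_mul_stdPdf 1).neg).add
    (integrable_stdPdf.const_mul (-(2 * y)))).comp_sub_right y
  refine h.congr (ae_of_all _ fun τ => ?_)
  simp only [Pi.add_apply, Pi.neg_apply]
  ring

lemma hasDerivAt_add_mul_stdPdf_sub (y τ : ℝ) :
    HasDerivAt (fun τ : ℝ => -(τ + y) * stdPdf (τ - y))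
      (τ ^ 2 * stdPdf (τ - y) - (1 + y ^ 2) * stdPdf (τ - y)) τ := by
  have h := (((hasDerivAt_id τ).add_const y).neg).mul
    ((hasDerivAt_stdPdf (τ - y)).comp_sub_const τ y)
  convert! h using 1
  simp
  ring

lemma integrable_sq_mul_stdPdf_sub_sub (y : ℝ) :
    Integrable fun τ : ℝ => τ ^ 2 * stdPdf (τ - y) - (1 + y ^ 2) * stdPdf (τ - y) :=
  (integrable_sq_mul_stdPdf_sub y).sub ((integrable_stdPdf_sub y).const_mul _)

lemma integral_sq_mul_stdPdf_sub (y : ℝ) : ∫ τ, τ ^ 2 * stdPdf (τ - y) = 1 + y ^ 2 := by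
  have h := integral_eq_zero_of_hasDerivAt_of_integrable (hasDerivAt_add_mul_stdPdf_sub y)
    (integrable_sq_mul_stdPdf_sub_sub y) (integrable_add_mul_stdPdf_sub y)
  rw [integral_sub (integrable_sq_mul_stdPdf_sub y) ((integrable_stdPdf_sub y).const_mul _),
    integral_const_mul, integral_sub_right_eq_self stdPdf y, integral_stdPdf] at h
  linarith

lemma setIntegral_Ici_sq_mul_stdPdf_sub (y : ℝ) :
    ∫ τ in Set.Ici (0 : ℝ), τ ^ 2 * stdPdf (τ - y)
      = (1 + y ^ 2) * stdCdf y + y * stdPdf y := by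
  have hlim := tendsto_zero_of_hasDerivAt_of_integrableOn_Ioi (a := (0 : ℝ))
    (fun τ _ => hasDerivAt_add_mul_stdPdf_sub y τ)
    (integrable_sq_mul_stdPdf_sub_sub y).integrableOn
    (integrable_add_mul_stdPdf_sub y).integrableOn
  have h := integral_Ioi_of_hasDerivAt_of_tendsto' (a := (0 : ℝ))
    (fun τ _ => hasDerivAt_add_mul_stdPdf_sub y τ)
    (integrable_sq_mul_stdPdf_sub_sub y).integrableOn hlim
  rw [integral_sub (integrable_sq_mul_stdPdf_sub y).integrableOn
    ((integrable_stdPdf_sub y).const_mul _).integrableOn, integral_const_mul,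
    setIntegral_Ioi_stdPdf_sub, zero_sub y, stdPdf_neg] at h
  rw [integral_Ici_eq_integral_Ioi]
  linarith

theorem stmt7 :
    (∀ x : ℝ, 0 < Psi x)
    ∧ ∀ ybar : ℝ,
        (∫ τ in Set.Ici (0:ℝ), τ ^ 2 * stdPdf (τ - ybar))
            / (∫ τ, τ ^ 2 * stdPdf (τ - ybar))
          = stdCdf ybar * (1 + ybar * Psi ybar) := by
  refine ⟨fun x => ?_, fun y => ?_⟩
  · have := stdPdf_pos x
    have := stdCdf_pos x
    unfold Psi
    positivity
  · have hcdf := (stdCdf_pos y).ne'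
    have hy : 1 + y ^ 2 ≠ 0 := by positivity
    rw [setIntegral_Ici_sq_mul_stdPdf_sub, integral_sq_mul_stdPdf_sub, Psi]
    field_simp
end

section
/- For every τ > 0, if Y is distributed according to the Gaussian measure N(τ, 1) on ℝ, then E[1 / (exp(2τY) + 1)] = 2·E[(1 / (exp(2τY) + 1))²]. -/
open MeasureTheory ProbabilityTheory

/-- Reflecting the density of `N(τ, 1)` multiplies it by `exp (-2τy)`. -/
lemma gaussianPDFReal_neg_mul_exp (τ y : ℝ) :
    gaussianPDFReal τ 1 (-y) * Real.exp (2 * τ * y) = gaussianPDFReal τ 1 y := by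
  simp only [gaussianPDFReal, mul_assoc, ← Real.exp_add]
  congr 3
  push_cast
  ring

lemma integrable_logistic_pow (μ : Measure ℝ) [IsFiniteMeasure μ] (c : ℝ) (n : ℕ) :
    Integrable (fun y ↦ (1 / (Real.exp (c * y) + 1)) ^ n) μ := by
  refine Integrable.of_bound (C := 1) (Measurable.aestronglyMeasurable (by fun_prop))
    (ae_of_all _ fun y ↦ ?_)
  have h := Real.exp_pos (c * y)
  rw [Real.norm_of_nonneg (by positivity)]
  exact pow_le_one₀ (by positivity) (by rw [div_le_one (by positivity)]; linarith)

/-- The reflection `y ↦ -y` exchanges `p (1 - p)` and `p ^ 2` under `N(τ, 1)`, where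
`p = 1 / (exp (2τy) + 1)`. -/
lemma integral_logistic_sub_sq_gaussianReal (τ : ℝ) :
    ∫ y, (1 / (Real.exp (2 * τ * y) + 1) - (1 / (Real.exp (2 * τ * y) + 1)) ^ 2)
        ∂(gaussianReal τ 1)
      = ∫ y, (1 / (Real.exp (2 * τ * y) + 1)) ^ 2 ∂(gaussianReal τ 1) := by
  rw [integral_gaussianReal_eq_integral_smul one_ne_zero,
    integral_gaussianReal_eq_integral_smul one_ne_zero, ← integral_neg_eq_self]
  congr 1 with y
  rw [← gaussianPDFReal_neg_mul_exp τ y, mul_neg, Real.exp_neg]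
  have h := Real.exp_pos (2 * τ * y)
  simp only [smul_eq_mul]
  field_simp
  ring

theorem stmt9 (τ : ℝ) (hτ : 0 < τ) :
    ∫ y, 1 / (Real.exp (2 * τ * y) + 1) ∂(gaussianReal τ 1)
      = 2 * ∫ y, (1 / (Real.exp (2 * τ * y) + 1)) ^ 2 ∂(gaussianReal τ 1) := by
  have h := integral_logistic_sub_sq_gaussianReal τ
  rw [integral_sub (by simpa using integrable_logistic_pow (gaussianReal τ 1) (2 * τ) 1)
    (integrable_logistic_pow _ _ 2)] at h
  linarith
end

section
/- Suppose δ* : ℝ → [0,1] is measurable and minimax optimal for mean square regret in the Gaussian experiment, i.e. sup_{τ∈ℝ} R_sq(δ*, τ) = inf over measurable δ : ℝ → [0,1] of sup_{τ∈ℝ} R_sq(δ, τ). Then the set of maximizers of τ ↦ R_sq(δ*, τ) is symmetric about zero: if τ₀ ∈ (0,∞) attains sup_{τ∈ℝ} R_sq(δ*, τ), then −τ₀ also attains it, i.e. R_sq(δ*, −τ₀) = R_sq(δ*, τ₀) = sup_{τ∈ℝ} R_sq(δ*, τ). -/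
open MeasureTheory ProbabilityTheory

/-- Mean square regret of a rule `δ` at state `τ` in the Gaussian experiment `N(τ,1)`. -/
noncomputable def Rsq (δ : ℝ → ℝ) (τ : ℝ) : ℝ :=
  τ ^ 2 * ∫ y, ((if 0 ≤ τ then (1:ℝ) else 0) - δ y) ^ 2 ∂(gaussianReal τ 1)

theorem integrable_of_mem_Icc {μ : Measure ℝ} [IsFiniteMeasure μ] {f : ℝ → ℝ}
    (hf : Measurable f) (h : ∀ y, f y ∈ Set.Icc (0:ℝ) 1) : Integrable f μ :=
  Integrable.of_bound hf.aestronglyMeasurable 1 (.of_forall fun y => by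
    rw [Real.norm_eq_abs, abs_le]; exact ⟨by linarith [(h y).1], (h y).2⟩)

theorem sq_sub_mem_Icc {x y : ℝ} (hx : x ∈ Set.Icc (0:ℝ) 1) (hy : y ∈ Set.Icc (0:ℝ) 1) :
    (x - y) ^ 2 ∈ Set.Icc (0:ℝ) 1 :=
  ⟨sq_nonneg _, by
    rw [sq_le_one_iff_abs_le_one, abs_le]
    constructor <;> linarith [hx.1, hx.2, hy.1, hy.2]⟩

theorem indicator_mem_Icc (p : Prop) [Decidable p] :
    (if p then (1:ℝ) else 0) ∈ Set.Icc (0:ℝ) 1 := by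
  split_ifs <;> simp

theorem Rsq_nonneg (δ : ℝ → ℝ) (τ : ℝ) : 0 ≤ Rsq δ τ :=
  mul_nonneg (sq_nonneg _) (integral_nonneg fun _ => sq_nonneg _)

theorem Rsq_le_sq {δ : ℝ → ℝ} (hδ : Measurable δ) (h : ∀ y, δ y ∈ Set.Icc (0:ℝ) 1) (τ : ℝ) :
    Rsq δ τ ≤ τ ^ 2 := by
  have hint : ∫ y, ((if 0 ≤ τ then (1:ℝ) else 0) - δ y) ^ 2 ∂(gaussianReal τ 1) ≤ 1 := by
    calc _ ≤ ∫ _, (1:ℝ) ∂(gaussianReal τ 1) :=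
          integral_mono (integrable_of_mem_Icc (by fun_prop)
            fun y => sq_sub_mem_Icc (indicator_mem_Icc _) (h y)) (integrable_const _)
            fun y => (sq_sub_mem_Icc (indicator_mem_Icc _) (h y)).2
      _ = 1 := by simp
  exact mul_le_of_le_one_right (sq_nonneg _) hint

/-- The mean square regret is quadratic along segments of treatment rules. -/
theorem Rsq_convex_comb {a b : ℝ → ℝ} (ha : Measurable a) (hb : Measurable b)
    (ha' : ∀ y, a y ∈ Set.Icc (0:ℝ) 1) (hb' : ∀ y, b y ∈ Set.Icc (0:ℝ) 1) (t τ : ℝ) :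
    Rsq (fun y => (1 - t) * a y + t * b y) τ = (1 - t) * Rsq a τ + t * Rsq b τ
      - t * (1 - t) * (τ ^ 2 * ∫ y, (a y - b y) ^ 2 ∂(gaussianReal τ 1)) := by
  unfold Rsq
  set i : ℝ := if 0 ≤ τ then (1:ℝ) else 0
  have hi : i ∈ Set.Icc (0:ℝ) 1 := indicator_mem_Icc _
  have h1 : Integrable (fun y => (i - a y) ^ 2) (gaussianReal τ 1) :=
    integrable_of_mem_Icc (by fun_prop) fun y => sq_sub_mem_Icc hi (ha' y)
  have h2 : Integrable (fun y => (i - b y) ^ 2) (gaussianReal τ 1) :=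
    integrable_of_mem_Icc (by fun_prop) fun y => sq_sub_mem_Icc hi (hb' y)
  have h3 : Integrable (fun y => (a y - b y) ^ 2) (gaussianReal τ 1) :=
    integrable_of_mem_Icc (by fun_prop) fun y => sq_sub_mem_Icc (ha' y) (hb' y)
  have h12 : Integrable (fun y => (1 - t) * (i - a y) ^ 2 + t * (i - b y) ^ 2)
      (gaussianReal τ 1) := (h1.const_mul _).add (h2.const_mul _)
  have key : ∫ y, (i - ((1 - t) * a y + t * b y)) ^ 2 ∂(gaussianReal τ 1)
      = (1 - t) * ∫ y, (i - a y) ^ 2 ∂(gaussianReal τ 1)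
        + t * ∫ y, (i - b y) ^ 2 ∂(gaussianReal τ 1)
        - t * (1 - t) * ∫ y, (a y - b y) ^ 2 ∂(gaussianReal τ 1) := by
    rw [← integral_const_mul, ← integral_const_mul, ← integral_const_mul,
      ← integral_add (h1.const_mul _) (h2.const_mul _),
      ← integral_sub h12 (h3.const_mul _)]
    congr 1 with y
    ring
  rw [key]
  ring

/-- Relabelling the two treatments reflects the regret function about zero. -/
theorem Rsq_reflect (δ : ℝ → ℝ) (τ : ℝ) :
    Rsq (fun y => 1 - δ (-y)) τ = Rsq δ (-τ) := by
  rcases eq_or_ne τ 0 with rfl | hτ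
  · simp [Rsq]
  unfold Rsq
  rw [neg_sq, ← gaussianReal_map_neg (μ := τ),
    MeasurableEmbedding.integral_map (f := fun y : ℝ => -y)
      (MeasurableEquiv.neg ℝ).measurableEmbedding]
  congr 2 with y
  rcases hτ.lt_or_gt with h | h
  · rw [if_neg h.not_ge, if_pos (by linarith)]
    ring
  · rw [if_pos h.le, if_neg (by linarith)]
    ring

theorem Rsq_congr_ae {a b : ℝ → ℝ} (h : a =ᵐ[volume] b) (τ : ℝ) : Rsq a τ = Rsq b τ := by
  unfold Rsq
  congr 1
  refine integral_congr_ae ?_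
  filter_upwards [(gaussianReal_absolutelyContinuous τ one_ne_zero).ae_le h] with y hy
  rw [hy]

/-- The regret of the sign rule has Gaussian decay at infinity. -/
theorem Rsq_sign_le (τ : ℝ) :
    Rsq (fun y => if 0 ≤ y then (1:ℝ) else 0) τ ≤ τ ^ 2 * Real.exp (-(τ ^ 2 / 2)) := by
  unfold Rsq
  refine mul_le_mul_of_nonneg_left ?_ (sq_nonneg _)
  rw [integral_gaussianReal_eq_integral_smul one_ne_zero]
  calc _ ≤ ∫ y, Real.exp (-(τ ^ 2 / 2)) * gaussianPDFReal 0 1 y := by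
        refine integral_mono_of_nonneg
          (.of_forall fun y => smul_nonneg (gaussianPDFReal_nonneg _ _ _) (sq_nonneg _))
          ((integrable_gaussianPDFReal 0 1).const_mul _) (.of_forall fun y => ?_)
        have key : y * τ ≤ 0 →
            gaussianPDFReal τ 1 y ≤ Real.exp (-(τ ^ 2 / 2)) * gaussianPDFReal 0 1 y := by
          intro h
          simp only [gaussianPDFReal, NNReal.coe_one, mul_one]
          rw [mul_left_comm, ← Real.exp_add]
          gcongr
          nlinarith
        have hnn : 0 ≤ Real.exp (-(τ ^ 2 / 2)) * gaussianPDFReal 0 1 y :=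
          mul_nonneg (Real.exp_nonneg _) (gaussianPDFReal_nonneg _ _ _)
        simp only [smul_eq_mul]
        split_ifs with h1 h2 h2
        · simpa using hnn
        · simpa using key (mul_nonpos_of_nonpos_of_nonneg (not_le.1 h2).le h1)
        · simpa using key (mul_nonpos_of_nonneg_of_nonpos h2 (not_le.1 h1).le)
        · simpa using hnn
    _ = _ := by rw [integral_const_mul, integral_gaussianPDFReal_eq_one 0 one_ne_zero, mul_one]

theorem sq_mul_exp_neg_le {τ : ℝ} (hτ : τ ≠ 0) :
    τ ^ 2 * Real.exp (-(τ ^ 2 / 2)) ≤ 8 / τ ^ 2 := by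
  have h0 : 0 < τ ^ 2 := by positivity
  have h := Real.quadratic_le_exp_of_nonneg (x := τ ^ 2 / 2) (by positivity)
  rw [Real.exp_neg, ← div_eq_mul_inv, div_le_div_iff₀ (Real.exp_pos _) h0]
  nlinarith

/-- Gaussian integrals of a nonnegative function that is not a.e. zero are bounded away from zero
when the mean ranges over a bounded set. -/
theorem exists_pos_le_integral_gaussianReal {g : ℝ → ℝ} (hg : Measurable g)
    (hg' : ∀ y, g y ∈ Set.Icc (0:ℝ) 1) (hne : ¬ g =ᵐ[volume] 0) (B : ℝ) :
    ∃ c > 0, ∀ τ : ℝ, τ ^ 2 ≤ B → c ≤ ∫ y, g y ∂(gaussianReal τ 1) := by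
  have hexp : Integrable fun y : ℝ => Real.exp (-1 * y ^ 2) := integrable_exp_neg_mul_sq one_pos
  have hbound : ∀ᵐ y, ‖g y‖ ≤ 1 := .of_forall fun y => by
    rw [Real.norm_of_nonneg (hg' y).1]; exact (hg' y).2
  have hint : Integrable fun y => Real.exp (-1 * y ^ 2) * g y :=
    hexp.mul_bdd hg.aestronglyMeasurable hbound
  have hpos : 0 < ∫ y, Real.exp (-1 * y ^ 2) * g y := by
    refine lt_of_le_of_ne (integral_nonneg fun y => mul_nonneg (Real.exp_nonneg _) (hg' y).1) ?_
    intro h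
    rw [eq_comm, integral_eq_zero_iff_of_nonneg
      (fun y => mul_nonneg (Real.exp_nonneg _) (hg' y).1) hint] at h
    refine hne ?_
    filter_upwards [h] with y hy
    simpa [Real.exp_ne_zero] using hy
  refine ⟨(√(2 * Real.pi))⁻¹ * Real.exp (-B) * ∫ y, Real.exp (-1 * y ^ 2) * g y,
    by positivity, fun τ hτ => ?_⟩
  rw [integral_gaussianReal_eq_integral_smul one_ne_zero, ← integral_const_mul]
  refine integral_mono (hint.const_mul _)
    ((integrable_gaussianPDFReal τ 1).mul_bdd hg.aestronglyMeasurable hbound) fun y => ?_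
  simp only [smul_eq_mul, ← mul_assoc]
  refine mul_le_mul_of_nonneg_right ?_ (hg' y).1
  simp only [gaussianPDFReal, NNReal.coe_one, mul_one]
  rw [mul_assoc, ← Real.exp_add]
  gcongr
  nlinarith [sq_nonneg (y + τ)]

/-- If the regret of `δ` is bounded by `M` and `δ` is not invariant under relabelling the
treatments, then some rule has regret uniformly below `M`. -/
theorem exists_rule_Rsq_le_lt {δ : ℝ → ℝ} (hδ : Measurable δ)
    (h : ∀ y, δ y ∈ Set.Icc (0:ℝ) 1) {M : ℝ} (hM : 0 < M) (hle : ∀ τ, Rsq δ τ ≤ M)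
    (hne : ¬ δ =ᵐ[volume] fun y => 1 - δ (-y)) :
    ∃ δ' : ℝ → ℝ, Measurable δ' ∧ (∀ y, δ' y ∈ Set.Icc (0:ℝ) 1) ∧
      ∃ M' < M, ∀ τ, Rsq δ' τ ≤ M' := by
  have hcomb : ∀ {a b : ℝ → ℝ} {t : ℝ}, t ∈ Set.Icc (0:ℝ) 1 → (∀ y, a y ∈ Set.Icc (0:ℝ) 1) →
      (∀ y, b y ∈ Set.Icc (0:ℝ) 1) → ∀ y, (1 - t) * a y + t * b y ∈ Set.Icc (0:ℝ) 1 :=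
    fun ht ha hb y => convex_Icc (0:ℝ) 1 (ha y) (hb y) (sub_nonneg.2 ht.2) ht.1 (by ring)
  set r : ℝ → ℝ := fun y => 1 - δ (-y) with hr
  have hrm : Measurable r := by fun_prop
  have hr' : ∀ y, r y ∈ Set.Icc (0:ℝ) 1 := fun y =>
    ⟨by linarith [(h (-y)).2], by linarith [(h (-y)).1]⟩
  set m : ℝ → ℝ := fun y => (1 - 1 / 2) * δ y + 1 / 2 * r y with hm
  have hmm : Measurable m := by fun_prop
  have hm' : ∀ y, m y ∈ Set.Icc (0:ℝ) 1 := hcomb (by norm_num) h hr'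
  set s : ℝ → ℝ := fun y => if 0 ≤ y then (1:ℝ) else 0 with hs
  have hsm : Measurable s := Measurable.ite measurableSet_Ici measurable_const measurable_const
  have hs' : ∀ y, s y ∈ Set.Icc (0:ℝ) 1 := fun y => indicator_mem_Icc _
  obtain ⟨c, hc, hcle⟩ := exists_pos_le_integral_gaussianReal (g := fun y => (δ y - r y) ^ 2)
    (by fun_prop) (fun y => sq_sub_mem_Icc (h y) (hr' y)) (fun hz => hne (by
      filter_upwards [hz] with y hy
      exact sub_eq_zero.1 (pow_eq_zero_iff two_ne_zero |>.1 hy))) (16 / M)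
  have hmM : ∀ τ, Rsq m τ ≤ M - 1 / 4 *
      (τ ^ 2 * ∫ y, (δ y - r y) ^ 2 ∂(gaussianReal τ 1)) := fun τ => by
    rw [hm, Rsq_convex_comb hδ hrm h hr', hr, Rsq_reflect]
    linarith [hle τ, hle (-τ)]
  have hmM' : ∀ τ, Rsq m τ ≤ M := fun τ => (hmM τ).trans <| by
    have : 0 ≤ ∫ y, (δ y - r y) ^ 2 ∂(gaussianReal τ 1) := integral_nonneg fun y => sq_nonneg _
    nlinarith [mul_nonneg (sq_nonneg τ) this]
  obtain ⟨η, hη, hηM, hηc⟩ : ∃ η > 0, η ≤ M / 2 ∧ η ≤ M * c / 8 :=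
    ⟨min (M / 2) (M * c / 8), lt_min (by positivity) (by positivity), min_le_left _ _,
      min_le_right _ _⟩
  have hcompact : ∀ τ : ℝ, τ ^ 2 ≤ 16 / M → Rsq m τ ≤ M - η := fun τ hτ => by
    rcases le_total (τ ^ 2) (M / 2) with h1 | h1
    · linarith [Rsq_le_sq hmm hm' τ]
    · have : M / 2 * c ≤ τ ^ 2 * ∫ y, (δ y - r y) ^ 2 ∂(gaussianReal τ 1) :=
        mul_le_mul h1 (hcle τ hτ) hc.le (sq_nonneg _)
      linarith [hmM τ]
  have hB : 0 < 16 / M := by positivity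
  obtain ⟨ε, hε, hε1, hεη⟩ : ∃ ε > 0, ε ≤ 1 ∧ ε * (16 / M) ≤ η / 2 := by
    refine ⟨min 1 (η / 2 / (16 / M)), lt_min one_pos (by positivity), min_le_left _ _, ?_⟩
    rw [← le_div_iff₀ hB]
    exact min_le_right _ _
  refine ⟨fun y => (1 - ε) * m y + ε * s y, by fun_prop, hcomb ⟨hε.le, hε1⟩ hm' hs',
    max (M - ε * M / 2) (M - η / 2), max_lt (by nlinarith [mul_pos hε hM]) (by linarith),
    fun τ => ?_⟩
  have hconv : Rsq (fun y => (1 - ε) * m y + ε * s y) τ ≤ (1 - ε) * Rsq m τ + ε * Rsq s τ := by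
    rw [Rsq_convex_comb hmm hsm hm' hs']
    have : 0 ≤ ∫ y, (m y - s y) ^ 2 ∂(gaussianReal τ 1) := integral_nonneg fun y => sq_nonneg _
    have := mul_nonneg (mul_nonneg hε.le (sub_nonneg.2 hε1)) (mul_nonneg (sq_nonneg τ) this)
    linarith
  refine hconv.trans ?_
  have hε1' : 0 ≤ 1 - ε := sub_nonneg.2 hε1
  rcases le_total (τ ^ 2) (16 / M) with hτ | hτ
  · refine le_max_of_le_right ?_
    have h1 := mul_le_mul_of_nonneg_left (hcompact τ hτ) hε1'
    have h2 := mul_le_mul_of_nonneg_left ((Rsq_le_sq hsm hs' τ).trans hτ) hε.le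
    have h3 : 0 ≤ ε * (M - η) := mul_nonneg hε.le (by linarith)
    linarith
  · refine le_max_of_le_left ?_
    have hτ0 : 0 < τ ^ 2 := hB.trans_le hτ
    have hsM : Rsq s τ ≤ M / 2 := by
      refine (Rsq_sign_le τ).trans ((sq_mul_exp_neg_le (pow_ne_zero_iff two_ne_zero |>.1
        hτ0.ne')).trans ?_)
      rw [div_le_iff₀ hM] at hτ
      rw [div_le_iff₀ hτ0]
      linarith
    have h1 := mul_le_mul_of_nonneg_left (hmM' τ) hε1'
    have h2 := mul_le_mul_of_nonneg_left hsM hε.le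
    linarith

/-- If `δ*` is minimax optimal (its worst-case mean square regret is no larger than that of
any measurable `[0,1]`-valued rule, expressed via upper bounds `M`), and `τ₀ > 0` attains
the supremum of `τ ↦ R_sq(δ*, τ)`, then `−τ₀` attains it as well. -/
theorem stmt12 (δs : ℝ → ℝ) (hmeas : Measurable δs)
    (hrange : ∀ y, δs y ∈ Set.Icc (0:ℝ) 1)
    (hminimax : ∀ δ : ℝ → ℝ, Measurable δ → (∀ y, δ y ∈ Set.Icc (0:ℝ) 1) →
      ∀ M : ℝ, (∀ τ, Rsq δ τ ≤ M) → ∀ τ, Rsq δs τ ≤ M)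
    (τ₀ : ℝ) (hτ₀ : 0 < τ₀)
    (hmax : ∀ τ, Rsq δs τ ≤ Rsq δs τ₀) :
    Rsq δs (-τ₀) = Rsq δs τ₀ ∧ ∀ τ, Rsq δs τ ≤ Rsq δs (-τ₀) := by
  suffices h : Rsq δs (-τ₀) = Rsq δs τ₀ from ⟨h, fun τ => (hmax τ).trans_eq h.symm⟩
  rcases (Rsq_nonneg δs τ₀).eq_or_lt with h0 | h0
  · exact le_antisymm (hmax _) (h0 ▸ Rsq_nonneg _ _)
  by_cases hsymm : δs =ᵐ[volume] fun y => 1 - δs (-y)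
  · rw [← Rsq_reflect, Rsq_congr_ae hsymm τ₀]
  · obtain ⟨δ, hδ, hδ', M, hlt, hle⟩ := exists_rule_Rsq_le_lt hmeas hrange h0 hmax hsymm
    exact absurd (hminimax δ hδ hδ' M hle τ₀) hlt.not_ge
end

section
/- Let φ denote the standard normal density. Suppose τ* ∈ (0,∞) maximizes over τ ∈ [0,∞) the function G(τ) := τ²·∫ (1/(exp(2τy)+1))²·φ(y − τ) dy. Then the function R(τ) := τ²·∫ (1/(exp(2τ*y)+1))²·φ(y − τ) dy is differentiable at τ* with derivative zero: R′(τ*) = 0. -/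
open MeasureTheory ProbabilityTheory

/-- `G(τ) = τ²·E_{Y∼N(τ,1)}[(1/(exp(2τY)+1))²]`, the frequentist mean square regret at
state `τ` of the Bayes rule for the symmetric two-point prior supported on `{τ, −τ}`. -/
noncomputable def Gfun (τ : ℝ) : ℝ :=
  τ ^ 2 * ∫ y, (1 / (Real.exp (2 * τ * y) + 1)) ^ 2 ∂(gaussianReal τ 1)

theorem integrable_inv_exp_add_one_mul (μ : Measure ℝ) [IsFiniteMeasure μ] (s t : ℝ) :
    Integrable (fun y => 1 / (Real.exp (2 * s * y) + 1) * (1 / (Real.exp (2 * t * y) + 1))) μ := by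
  have hle : ∀ u : ℝ, 1 / (Real.exp u + 1) ≤ 1 := fun u => by
    rw [div_le_one (by positivity)]
    linarith [Real.exp_pos u]
  refine Integrable.of_bound (C := 1) (Measurable.aestronglyMeasurable (by fun_prop)) ?_
  refine Filter.Eventually.of_forall fun y => ?_
  rw [Real.norm_of_nonneg (by positivity)]
  exact mul_le_one₀ (hle _) (by positivity) (hle _)

/-- The Bayes rule is orthogonal to its difference from any other logistic rule: against the
density of `N(t,1)` the product is an odd function. -/
theorem integral_gaussianReal_bayes_mul_sub_eq_zero (s t : ℝ) :
    ∫ y, 1 / (Real.exp (2 * t * y) + 1) *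
      (1 / (Real.exp (2 * s * y) + 1) - 1 / (Real.exp (2 * t * y) + 1)) ∂(gaussianReal t 1) = 0 := by
  rw [integral_gaussianReal_eq_integral_smul one_ne_zero]
  set h : ℝ → ℝ := fun y => gaussianPDFReal t 1 y • (1 / (Real.exp (2 * t * y) + 1) *
      (1 / (Real.exp (2 * s * y) + 1) - 1 / (Real.exp (2 * t * y) + 1))) with hh
  have hodd : ∀ y, h (-y) = -h y := by
    intro y
    have hpdf : gaussianPDFReal t 1 y = gaussianPDFReal t 1 (-y) * Real.exp (2 * t * y) := by
      simp only [gaussianPDFReal, mul_assoc, ← Real.exp_add]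
      congr 3
      simp only [NNReal.coe_one]
      ring
    have hflip : ∀ r : ℝ, Real.exp (2 * r * -y) = (Real.exp (2 * r * y))⁻¹ := fun r => by
      rw [← Real.exp_neg]
      congr 1
      ring
    simp only [hh, hpdf, hflip, smul_eq_mul]
    have hs := Real.exp_pos (2 * s * y)
    have ht := Real.exp_pos (2 * t * y)
    field_simp
    ring
  have key : ∫ y, h y = -∫ y, h y := by
    conv_lhs => rw [← integral_neg_eq_self]
    simp only [hodd, integral_neg]
  linarith

/-- Among logistic rules, the one with parameter `t` has the least mean square regret at `t`. -/
theorem integral_gaussianReal_bayes_le (s t : ℝ) :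
    ∫ y, (1 / (Real.exp (2 * t * y) + 1)) ^ 2 ∂(gaussianReal t 1) ≤
      ∫ y, (1 / (Real.exp (2 * s * y) + 1)) ^ 2 ∂(gaussianReal t 1) := by
  have hss := integrable_inv_exp_add_one_mul (gaussianReal t 1) s s
  have htt := integrable_inv_exp_add_one_mul (gaussianReal t 1) t t
  have hts := integrable_inv_exp_add_one_mul (gaussianReal t 1) t s
  have hcross : Integrable (fun y => 1 / (Real.exp (2 * t * y) + 1) *
      (1 / (Real.exp (2 * s * y) + 1) - 1 / (Real.exp (2 * t * y) + 1))) (gaussianReal t 1) := by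
    simp only [mul_sub]
    exact hts.sub htt
  simp only [← pow_two] at hss htt
  have hmono := integral_mono (htt.add (hcross.const_mul 2)) hss fun y => by
    simp only [Pi.add_apply]
    nlinarith [sq_nonneg (1 / (Real.exp (2 * s * y) + 1) - 1 / (Real.exp (2 * t * y) + 1))]
  rw [integral_add' htt (hcross.const_mul 2), integral_const_mul,
    integral_gaussianReal_bayes_mul_sub_eq_zero] at hmono
  simpa using hmono

theorem hasDerivAt_sq_inv_exp_add_one (u : ℝ) :
    HasDerivAt (fun u => (1 / (Real.exp (2 * u) + 1)) ^ 2)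
      (-(4 * Real.exp (2 * u)) / (Real.exp (2 * u) + 1) ^ 3) u := by
  have hlin : HasDerivAt (fun u : ℝ => 2 * u) 2 u := by
    simpa using (hasDerivAt_id u).const_mul 2
  have hpos : Real.exp (2 * u) + 1 ≠ 0 := by positivity
  have h := ((hlin.exp.add_const 1).fun_inv hpos).fun_pow 2
  simp only [one_div]
  refine h.congr_deriv ?_
  push_cast
  field_simp
  ring

theorem abs_deriv_sq_inv_exp_add_one_le (u : ℝ) :
    |-(4 * Real.exp (2 * u)) / (Real.exp (2 * u) + 1) ^ 3| ≤ 4 := by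
  have h := Real.exp_pos (2 * u)
  rw [abs_div, abs_neg, abs_of_pos (by positivity), abs_of_pos (by positivity),
    div_le_iff₀ (by positivity)]
  nlinarith [pow_pos h 2, pow_pos h 3]

theorem differentiableAt_integral_gaussianReal_logistic (a b t₀ : ℝ) :
    DifferentiableAt ℝ (fun t => ∫ y, (1 / (Real.exp (2 * (a + b * t) * y) + 1)) ^ 2
      ∂(gaussianReal t 1)) t₀ := by
  have hshift : (fun t => ∫ y, (1 / (Real.exp (2 * (a + b * t) * y) + 1)) ^ 2
      ∂(gaussianReal t 1)) = fun t => ∫ y, (1 / (Real.exp (2 * ((a + b * t) * (y + t))) + 1)) ^ 2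
      ∂(gaussianReal 0 1) := by
    ext t
    have hmap := gaussianReal_map_add_const (μ := 0) (v := 1) t
    rw [zero_add] at hmap
    rw [← hmap, integral_map (by fun_prop) (Measurable.aestronglyMeasurable (by fun_prop))]
    simp only [mul_assoc]
  rw [hshift]
  refine (hasDerivAt_integral_of_dominated_loc_of_deriv_le (μ := gaussianReal 0 1)
    (F' := fun t y => -(4 * Real.exp (2 * ((a + b * t) * (y + t)))) /
      (Real.exp (2 * ((a + b * t) * (y + t))) + 1) ^ 3 * (b * (y + t) + (a + b * t)))
    (bound := fun y => 4 * (|b| * (|y| + (|t₀| + 1)) + (|a| + |b| * (|t₀| + 1))))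
    (Metric.ball_mem_nhds t₀ one_pos) ?_ ?_ ?_ ?_ ?_ ?_).2.differentiableAt
  · exact Filter.Eventually.of_forall fun t => Measurable.aestronglyMeasurable (by fun_prop)
  · refine Integrable.of_bound (C := 1) (Measurable.aestronglyMeasurable (by fun_prop)) ?_
    refine Filter.Eventually.of_forall fun y => ?_
    rw [Real.norm_of_nonneg (by positivity)]
    refine pow_le_one₀ (by positivity) ?_
    rw [div_le_one (by positivity)]
    linarith [Real.exp_pos (2 * ((a + b * t₀) * (y + t₀)))]
  · exact Measurable.aestronglyMeasurable (by fun_prop)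
  · refine Filter.Eventually.of_forall fun y t ht => ?_
    have ht' : |t| ≤ |t₀| + 1 := by
      rw [Metric.mem_ball, Real.dist_eq] at ht
      linarith [abs_sub_abs_le_abs_sub t t₀]
    rw [norm_mul, Real.norm_eq_abs, Real.norm_eq_abs]
    refine mul_le_mul (abs_deriv_sq_inv_exp_add_one_le _) ?_ (abs_nonneg _) (by norm_num)
    calc |b * (y + t) + (a + b * t)| ≤ |b * (y + t)| + |a + b * t| := abs_add_le _ _
      _ ≤ |b| * (|y| + |t|) + (|a| + |b| * |t|) := by
        rw [abs_mul, ← abs_mul b t]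
        gcongr <;> exact abs_add_le _ _
      _ ≤ _ := by gcongr
  · have hid : Integrable (fun y : ℝ => |y|) (gaussianReal 0 1) :=
      ((memLp_id_gaussianReal 1).integrable (by norm_num)).abs
    fun_prop
  · refine Filter.Eventually.of_forall fun y t _ => ?_
    have h₁ : HasDerivAt (fun t => a + b * t) b t := by
      simpa using ((hasDerivAt_id t).const_mul b).const_add a
    have h₂ : HasDerivAt (fun t => y + t) 1 t := (hasDerivAt_id t).const_add y
    have h := h₁.fun_mul h₂
    rw [mul_one] at h
    exact (hasDerivAt_sq_inv_exp_add_one _).comp t h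

/-- If `τ* > 0` maximizes `G` over `[0,∞)`, then the mean square regret
`R(τ) = τ²·E_{Y∼N(τ,1)}[(1/(exp(2τ*Y)+1))²]` of the logistic rule with parameter `τ*`
has derivative zero at `τ = τ*`. -/
theorem stmt13 (τs : ℝ) (hτs : 0 < τs)
    (hmax : ∀ τ : ℝ, 0 ≤ τ → Gfun τ ≤ Gfun τs) :
    HasDerivAt
      (fun τ : ℝ => τ ^ 2 * ∫ y, (1 / (Real.exp (2 * τs * y) + 1)) ^ 2 ∂(gaussianReal τ 1))
      0 τs := by
  set R : ℝ → ℝ :=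
    fun τ => τ ^ 2 * ∫ y, (1 / (Real.exp (2 * τs * y) + 1)) ^ 2 ∂(gaussianReal τ 1) with hR
  have hRd : DifferentiableAt ℝ R τs := by
    have h := differentiableAt_integral_gaussianReal_logistic τs 0 τs
    simp only [zero_mul, add_zero] at h
    exact (differentiableAt_id.pow 2).mul h
  have hGd : DifferentiableAt ℝ Gfun τs := by
    have h := differentiableAt_integral_gaussianReal_logistic 0 1 τs
    simp only [one_mul, zero_add] at h
    exact (differentiableAt_id.pow 2).mul h
  have hG : deriv Gfun τs = 0 := by
    refine IsLocalMax.deriv_eq_zero ?_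
    filter_upwards [lt_mem_nhds hτs] with τ hτ using hmax τ hτ.le
  have hmin : IsLocalMin (fun τ => R τ - Gfun τ) τs := by
    refine Filter.Eventually.of_forall fun τ => ?_
    have hle : Gfun τ ≤ R τ :=
      mul_le_mul_of_nonneg_left (integral_gaussianReal_bayes_le τs τ) (sq_nonneg τ)
    have heq : R τs = Gfun τs := rfl
    simpa [heq] using hle
  have hdiff := hmin.hasDerivAt_eq_zero (hRd.hasDerivAt.fun_sub hGd.hasDerivAt)
  rw [hG, sub_zero] at hdiff
  exact hdiff ▸ hRd.hasDerivAt
end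

section
/- Let φ denote the standard normal density. Suppose τ* ∈ (0,∞) maximizes over τ ∈ [0,∞) the function G(τ) := τ²·∫ (1/(exp(2τy)+1))²·φ(y − τ) dy. Then τ* is the unique maximizer over [0,∞) of R(τ) := τ²·∫ (1/(exp(2τ*y)+1))²·φ(y − τ) dy: for every τ ∈ [0,∞) with τ ≠ τ*, R(τ) < R(τ*). -/
open MeasureTheory ProbabilityTheory

/-- `R(τ) = τ²·E_{Y∼N(τ,1)}[(1/(exp(2τ*Y)+1))²]`, the mean square regret at state `τ > 0`
of the logistic rule with fixed parameter `τ*`. -/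
noncomputable def Rfun (τs τ : ℝ) : ℝ :=
  τ ^ 2 * ∫ y, (1 / (Real.exp (2 * τs * y) + 1)) ^ 2 ∂(gaussianReal τ 1)

/-- The logistic weight `1 / (exp (c y) + 1)`. -/
noncomputable def logisticWeight (c y : ℝ) : ℝ := 1 / (Real.exp (c * y) + 1)

lemma logisticWeight_pos (c y : ℝ) : 0 < logisticWeight c y := by
  unfold logisticWeight; positivity

lemma logisticWeight_le_one (c y : ℝ) : logisticWeight c y ≤ 1 := by
  unfold logisticWeight
  rw [div_le_one (by positivity)]
  linarith [Real.exp_pos (c * y)]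

lemma continuous_logisticWeight (c : ℝ) : Continuous (logisticWeight c) := by
  unfold logisticWeight
  exact continuous_const.div (by fun_prop) fun y => by positivity

lemma logisticWeight_neg (c y : ℝ) :
    logisticWeight c (-y) = 1 - logisticWeight c y := by
  unfold logisticWeight
  rw [mul_neg, Real.exp_neg]
  have := Real.exp_pos (c * y)
  field_simp
  ring

lemma abs_inv_exp_add_one_sub_le (u v : ℝ) :
    |1 / (Real.exp u + 1) - 1 / (Real.exp v + 1)| ≤ |u - v| := by
  wlog h : u ≤ v generalizing u v
  · rw [abs_sub_comm, abs_sub_comm u]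
    exact this v u (le_of_not_ge h)
  have hu := Real.exp_pos u
  have hv := Real.exp_pos v
  have huv := Real.exp_le_exp.2 h
  have h1 : Real.exp v - Real.exp u ≤ (v - u) * Real.exp v := by
    have h2 := Real.add_one_le_exp (u - v)
    rw [Real.exp_sub, le_div_iff₀ hv] at h2
    linarith
  rw [abs_of_nonneg (sub_nonneg.2 (one_div_le_one_div_of_le (by positivity) (by linarith))),
    abs_of_nonpos (by linarith), div_sub_div _ _ (by positivity) (by positivity),
    div_le_iff₀ (by positivity)]
  nlinarith [mul_nonneg (sub_nonneg.2 h) (by positivity :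
    0 ≤ Real.exp u * Real.exp v + Real.exp u + 1)]

lemma integrable_logisticWeight_sq (c τ : ℝ) :
    Integrable (fun y => logisticWeight c y ^ 2) (gaussianReal τ 1) := by
  refine Integrable.of_bound ((continuous_logisticWeight c).pow 2).aestronglyMeasurable 1
    (ae_of_all _ fun y => ?_)
  rw [Real.norm_eq_abs, abs_of_nonneg (sq_nonneg _)]
  exact pow_le_one₀ (logisticWeight_pos c y).le (logisticWeight_le_one c y)

/-- The expected squared logistic weight under `N(τ,1)`. -/
noncomputable def logisticMean (c τ : ℝ) : ℝ :=
  ∫ y, logisticWeight c y ^ 2 ∂(gaussianReal τ 1)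

lemma logisticMean_pos (c τ : ℝ) : 0 < logisticMean c τ := by
  refine (integral_pos_iff_support_of_nonneg (fun y => sq_nonneg _)
    (integrable_logisticWeight_sq c τ)).2 ?_
  have : Function.support (fun y => logisticWeight c y ^ 2) = Set.univ :=
    Set.eq_univ_of_forall fun y => (pow_pos (logisticWeight_pos c y) 2).ne'
  rw [this]
  simp

/-- Basic composition (Cauchy–Binet) inequality for two-by-two determinants. -/
lemma integral_mul_integral_le_of_det_mul_det_nonneg {A B p q : ℝ → ℝ}
    (hAp : Integrable fun z => p z * A z) (hAq : Integrable fun z => q z * A z)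
    (hBp : Integrable fun z => p z * B z) (hBq : Integrable fun z => q z * B z)
    (h : ∀ x y, 0 ≤ (A x * B y - A y * B x) * (p x * q y - p y * q x)) :
    (∫ z, q z * A z) * (∫ z, p z * B z) ≤ (∫ z, p z * A z) * (∫ z, q z * B z) := by
  have h0 : 0 ≤ ∫ z : ℝ × ℝ, (A z.1 * B z.2 - A z.2 * B z.1) *
      (p z.1 * q z.2 - p z.2 * q z.1) ∂(volume.prod volume) :=
    integral_nonneg fun z => h z.1 z.2
  have e : ∀ z : ℝ × ℝ, (A z.1 * B z.2 - A z.2 * B z.1) * (p z.1 * q z.2 - p z.2 * q z.1) =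
      ((p z.1 * A z.1) * (q z.2 * B z.2) + (q z.1 * B z.1) * (p z.2 * A z.2)) -
      ((q z.1 * A z.1) * (p z.2 * B z.2) + (p z.1 * B z.1) * (q z.2 * A z.2)) :=
    fun z => by ring
  simp only [e] at h0
  have i1 : Integrable (fun z : ℝ × ℝ => (p z.1 * A z.1) * (q z.2 * B z.2) +
      (q z.1 * B z.1) * (p z.2 * A z.2)) (volume.prod volume) :=
    (hAp.mul_prod hBq).add (hBq.mul_prod hAp)
  have i2 : Integrable (fun z : ℝ × ℝ => (q z.1 * A z.1) * (p z.2 * B z.2) +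
      (p z.1 * B z.1) * (q z.2 * A z.2)) (volume.prod volume) :=
    (hAq.mul_prod hBp).add (hBp.mul_prod hAq)
  rw [integral_sub i1 i2,
    integral_add (hAp.mul_prod hBq) (hBq.mul_prod hAp),
    integral_add (hAq.mul_prod hBp) (hBp.mul_prod hAq),
    integral_prod_mul (fun z => p z * A z) (fun z => q z * B z),
    integral_prod_mul (fun z => q z * B z) (fun z => p z * A z),
    integral_prod_mul (fun z => q z * A z) (fun z => p z * B z),
    integral_prod_mul (fun z => p z * B z) (fun z => q z * A z)] at h0
  linarith

lemma gaussianPDFReal_mul_le {d x y : ℝ} (hd : 0 ≤ d) (hxy : x ≤ y) :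
    gaussianPDFReal 0 1 y * gaussianPDFReal d 1 x ≤
      gaussianPDFReal 0 1 x * gaussianPDFReal d 1 y := by
  simp only [gaussianPDFReal]
  rw [mul_mul_mul_comm, mul_mul_mul_comm _ (Real.exp _), ← Real.exp_add, ← Real.exp_add]
  gcongr ?_ * Real.exp ?_
  simp only [NNReal.coe_one]
  nlinarith [mul_nonneg hd (sub_nonneg.2 hxy)]

lemma logisticWeight_mul_le {c m d x y : ℝ} (hc : 0 ≤ c) (hd : 0 ≤ d) (hxy : x ≤ y) :
    logisticWeight c (m - y) * logisticWeight c (m + d - x) ≤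
      logisticWeight c (m - x) * logisticWeight c (m + d - y) := by
  unfold logisticWeight
  rw [div_mul_div_comm, div_mul_div_comm]
  refine div_le_div_of_nonneg_left (by norm_num) (by positivity) ?_
  have e1 : ∀ z, Real.exp (c * (m - z)) = Real.exp (c * m) * Real.exp (-(c * z)) := fun z => by
    rw [← Real.exp_add]; ring_nf
  have e2 : ∀ z, Real.exp (c * (m + d - z)) =
      Real.exp (c * m) * Real.exp (c * d) * Real.exp (-(c * z)) := fun z => by
    rw [← Real.exp_add, ← Real.exp_add]; ring_nf
  rw [e1, e1, e2, e2]
  have h1 : Real.exp (-(c * y)) ≤ Real.exp (-(c * x)) :=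
    Real.exp_le_exp.2 (neg_le_neg (mul_le_mul_of_nonneg_left hxy hc))
  have h2 : 1 ≤ Real.exp (c * d) := Real.one_le_exp (mul_nonneg hc hd)
  nlinarith [mul_nonneg (Real.exp_pos (c * m)).le
    (mul_nonneg (sub_nonneg.2 h1) (sub_nonneg.2 h2))]

lemma logisticMean_eq_integral (c x t : ℝ) :
    logisticMean c (x - t) =
      ∫ z, gaussianPDFReal t 1 z * logisticWeight c (x - z) ^ 2 := by
  unfold logisticMean
  have hc : Continuous fun y => logisticWeight c y ^ 2 := (continuous_logisticWeight c).pow 2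
  rw [← gaussianReal_map_const_sub, integral_map (by fun_prop) hc.aestronglyMeasurable,
    integral_gaussianReal_eq_integral_smul one_ne_zero]
  rfl

lemma integrable_gaussianPDFReal_mul (c x t : ℝ) :
    Integrable fun z => gaussianPDFReal t 1 z * logisticWeight c (x - z) ^ 2 := by
  have hc : Continuous fun z => logisticWeight c (x - z) ^ 2 :=
    ((continuous_logisticWeight c).comp (by fun_prop)).pow 2
  refine ((integrable_gaussianPDFReal t 1).bdd_mul (c := 1) hc.aestronglyMeasurable
    (ae_of_all _ fun z => ?_)).congr (ae_of_all _ fun z => mul_comm _ _)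
  rw [Real.norm_eq_abs, abs_of_nonneg (sq_nonneg _)]
  exact pow_le_one₀ (logisticWeight_pos c _).le (logisticWeight_le_one c _)

/-- Midpoint log-concavity of `logisticMean`. -/
lemma logisticMean_mul_le_sq {c : ℝ} (hc : 0 ≤ c) (a b : ℝ) :
    logisticMean c a * logisticMean c b ≤ logisticMean c ((a + b) / 2) ^ 2 := by
  wlog hab : a ≤ b generalizing a b
  · rw [mul_comm, add_comm]
    exact this b a (le_of_not_ge hab)
  obtain ⟨m, d, hd, rfl, rfl⟩ : ∃ m d : ℝ, 0 ≤ d ∧ a = m - d ∧ b = m + d :=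
    ⟨(a + b) / 2, (b - a) / 2, by linarith, by ring, by ring⟩
  have key := integral_mul_integral_le_of_det_mul_det_nonneg
    (integrable_gaussianPDFReal_mul c m 0) (integrable_gaussianPDFReal_mul c m d)
    (integrable_gaussianPDFReal_mul c (m + d) 0) (integrable_gaussianPDFReal_mul c (m + d) d)
    fun x y => by
      have hsq : ∀ {x y : ℝ}, x ≤ y →
          logisticWeight c (m - y) ^ 2 * logisticWeight c (m + d - x) ^ 2 ≤
          logisticWeight c (m - x) ^ 2 * logisticWeight c (m + d - y) ^ 2 := fun {x y} hxy => by
        rw [← mul_pow, ← mul_pow]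
        exact pow_le_pow_left₀
          (mul_pos (logisticWeight_pos _ _) (logisticWeight_pos _ _)).le
          (logisticWeight_mul_le hc hd hxy) 2
      rcases le_total x y with hxy | hxy
      · exact mul_nonneg (sub_nonneg.2 (hsq hxy)) (sub_nonneg.2 (gaussianPDFReal_mul_le hd hxy))
      · exact mul_nonneg_of_nonpos_of_nonpos (sub_nonpos.2 (hsq hxy))
          (sub_nonpos.2 (gaussianPDFReal_mul_le hd hxy))
  simp only [← logisticMean_eq_integral] at key
  rw [sub_zero, sub_zero, add_sub_cancel_right] at key
  rw [show (m - d + (m + d)) / 2 = m by ring, sq]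
  exact key

/-- Orthogonality of the Bayes error to differences of symmetric rules. -/
lemma integral_logisticWeight_mul_sub (c τ : ℝ) :
    ∫ y, logisticWeight (2 * τ) y * (logisticWeight c y - logisticWeight (2 * τ) y)
      ∂(gaussianReal τ 1) = 0 := by
  rw [integral_gaussianReal_eq_integral_smul one_ne_zero]
  set F : ℝ → ℝ := fun y => gaussianPDFReal τ 1 y •
    (logisticWeight (2 * τ) y * (logisticWeight c y - logisticWeight (2 * τ) y)) with hF
  have hodd : ∀ y, F (-y) = -F y := fun y => by
    simp only [hF, smul_eq_mul, logisticWeight_neg]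
    have h1 : gaussianPDFReal τ 1 (-y) * Real.exp (2 * τ * y) = gaussianPDFReal τ 1 y := by
      simp only [gaussianPDFReal]
      rw [mul_assoc, ← Real.exp_add]
      congr 2
      simp only [NNReal.coe_one]
      ring
    have h2 : 1 - logisticWeight (2 * τ) y =
        Real.exp (2 * τ * y) * logisticWeight (2 * τ) y := by
      unfold logisticWeight
      field_simp
      ring
    linear_combination (logisticWeight (2 * τ) y - logisticWeight c y) *
      (gaussianPDFReal τ 1 (-y) * h2 + logisticWeight (2 * τ) y * h1)
  have h := integral_neg_eq_self F volume
  simp only [hodd, integral_neg] at h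
  linarith

lemma integral_sq_gaussianReal (τ : ℝ) : ∫ y, y ^ 2 ∂(gaussianReal τ 1) = 1 + τ ^ 2 := by
  have h := variance_eq_sub (memLp_id_gaussianReal (μ := τ) (v := 1) 2)
  rw [variance_id_gaussianReal] at h
  simp only [Pi.pow_apply, id, integral_id_gaussianReal, NNReal.coe_one] at h
  linarith

lemma logisticMean_le (s τ : ℝ) :
    logisticMean (2 * s) τ ≤
      logisticMean (2 * τ) τ + 4 * (s - τ) ^ 2 * (1 + τ ^ 2) := by
  have hi : Integrable (fun y => logisticWeight (2 * τ) y *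
      (logisticWeight (2 * s) y - logisticWeight (2 * τ) y)) (gaussianReal τ 1) := by
    refine Integrable.of_bound ((continuous_logisticWeight _).mul
      ((continuous_logisticWeight _).sub (continuous_logisticWeight _))).aestronglyMeasurable 1
      (ae_of_all _ fun y => ?_)
    have := logisticWeight_pos (2 * τ) y
    have := logisticWeight_le_one (2 * τ) y
    have := logisticWeight_pos (2 * s) y
    have := logisticWeight_le_one (2 * s) y
    rw [Real.norm_eq_abs, abs_le]
    constructor <;> nlinarith
  have hsq : Integrable (fun y : ℝ => y ^ 2) (gaussianReal τ 1) :=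
    (memLp_id_gaussianReal (μ := τ) (v := 1) 2).integrable_sq
  have hadd : Integrable (fun y => logisticWeight (2 * τ) y ^ 2 + 2 * (logisticWeight (2 * τ) y *
      (logisticWeight (2 * s) y - logisticWeight (2 * τ) y))) (gaussianReal τ 1) :=
    (integrable_logisticWeight_sq _ _).add (hi.const_mul 2)
  calc logisticMean (2 * s) τ
      ≤ ∫ y, (logisticWeight (2 * τ) y ^ 2 + 2 * (logisticWeight (2 * τ) y *
          (logisticWeight (2 * s) y - logisticWeight (2 * τ) y))) +
          4 * (s - τ) ^ 2 * y ^ 2 ∂(gaussianReal τ 1) := by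
        refine integral_mono (integrable_logisticWeight_sq _ _)
          (hadd.add (hsq.const_mul _)) fun y => ?_
        have h := sq_le_sq.2 (abs_inv_exp_add_one_sub_le (2 * s * y) (2 * τ * y))
        change (logisticWeight (2 * s) y - logisticWeight (2 * τ) y) ^ 2 ≤ _ at h
        dsimp only
        nlinarith
    _ = logisticMean (2 * τ) τ + 4 * (s - τ) ^ 2 * (1 + τ ^ 2) := by
        rw [integral_add hadd (hsq.const_mul _),
          integral_add (integrable_logisticWeight_sq _ _) (hi.const_mul 2),
          integral_const_mul, integral_const_mul, integral_logisticWeight_mul_sub,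
          integral_sq_gaussianReal, mul_zero, add_zero]
        rfl

lemma Rfun_eq (s τ : ℝ) : Rfun s τ = τ ^ 2 * logisticMean (2 * s) τ := rfl

lemma Gfun_eq (τ : ℝ) : Gfun τ = τ ^ 2 * logisticMean (2 * τ) τ := rfl

lemma Rfun_pos (s : ℝ) {τ : ℝ} (hτ : 0 < τ) : 0 < Rfun s τ :=
  mul_pos (pow_pos hτ 2) (logisticMean_pos _ _)

lemma Rfun_le (s τ : ℝ) :
    Rfun s τ ≤ Gfun τ + 4 * τ ^ 2 * (1 + τ ^ 2) * (s - τ) ^ 2 := by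
  rw [Rfun_eq, Gfun_eq]
  nlinarith [mul_le_mul_of_nonneg_left (logisticMean_le s τ) (sq_nonneg τ)]

lemma Rfun_mul_lt_sq {s a b : ℝ} (hs : 0 ≤ s) (ha : 0 < a) (hb : 0 < b) (hab : a ≠ b) :
    Rfun s a * Rfun s b < Rfun s ((a + b) / 2) ^ 2 := by
  have h1 := logisticMean_mul_le_sq (c := 2 * s) (by positivity) a b
  have h2 : a * b < ((a + b) / 2) ^ 2 := by nlinarith [sq_pos_of_ne_zero (sub_ne_zero.2 hab)]
  have h3 : (a * b) ^ 2 < (((a + b) / 2) ^ 2) ^ 2 := pow_lt_pow_left₀ h2 (by positivity) two_ne_zero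
  have h4 := mul_pos (logisticMean_pos (2 * s) a) (logisticMean_pos (2 * s) b)
  simp only [Rfun_eq]
  calc _ = (a * b) ^ 2 * (logisticMean (2 * s) a * logisticMean (2 * s) b) := by ring
    _ < (((a + b) / 2) ^ 2) ^ 2 * (logisticMean (2 * s) a * logisticMean (2 * s) b) :=
      mul_lt_mul_of_pos_right h3 h4
    _ ≤ (((a + b) / 2) ^ 2) ^ 2 * logisticMean (2 * s) ((a + b) / 2) ^ 2 := by gcongr
    _ = _ := by ring

lemma log_Rfun_lt {s a b : ℝ} (hs : 0 ≤ s) (ha : 0 < a) (hb : 0 < b) (hab : a ≠ b) :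
    Real.log (Rfun s a) + Real.log (Rfun s b) < 2 * Real.log (Rfun s ((a + b) / 2)) := by
  have h := Real.log_lt_log (mul_pos (Rfun_pos s ha) (Rfun_pos s hb)) (Rfun_mul_lt_sq hs ha hb hab)
  rwa [Real.log_mul (Rfun_pos s ha).ne' (Rfun_pos s hb).ne', Real.log_pow, Nat.cast_ofNat] at h

/-- If `τ* > 0` maximizes `G` over `[0,∞)`, then `τ*` is the unique maximizer of
`R` over `[0,∞)`. -/
theorem stmt14 (τs : ℝ) (hτs : 0 < τs)
    (hmax : ∀ τ : ℝ, 0 ≤ τ → Gfun τ ≤ Gfun τs) :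
    ∀ τ : ℝ, 0 ≤ τ → τ ≠ τs → Rfun τs τ < Rfun τs τs := by
  intro τ hτ hne
  have hpos := Rfun_pos τs hτs
  rcases hτ.eq_or_lt with rfl | hτ
  · simpa [Rfun_eq] using hpos
  by_contra! hcon
  have hlog : Real.log (Rfun τs τs) ≤ Real.log (Rfun τs τ) := Real.log_le_log hpos hcon
  set m : ℕ → ℝ := fun n => τs + (τ - τs) * (1 / 2) ^ (n + 1) with hm
  have hp0 : ∀ n : ℕ, (0 : ℝ) < (1 / 2) ^ n := fun n => by positivity
  have hp1 : ∀ n : ℕ, ((1 : ℝ) / 2) ^ n ≤ 1 := fun n => pow_le_one₀ (by norm_num) (by norm_num)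
  have hmpos : ∀ n, 0 < m n := fun n => by
    simp only [hm]
    nlinarith [hp1 n, hp0 n, pow_succ ((1 : ℝ) / 2) n, mul_pos hτ (hp0 (n + 1))]
  have hmle : ∀ n, m n ≤ τs + τ := fun n => by
    simp only [hm]
    nlinarith [hp1 (n + 1), hp0 (n + 1)]
  have hmne : ∀ n, τs ≠ m n := fun n h => by
    have h1 : (τ - τs) * (1 / 2) ^ (n + 1) = 0 := by simp only [hm] at h; linarith
    rcases mul_eq_zero.1 h1 with h2 | h2
    · exact hne (sub_eq_zero.1 h2)
    · exact (hp0 (n + 1)).ne' h2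
  have hmsucc : ∀ n, m (n + 1) = (τs + m n) / 2 := fun n => by
    simp only [hm]; ring
  set L := Real.log (Rfun τs (m 0)) - Real.log (Rfun τs τs) with hL
  have hLpos : 0 < L := by
    have h := log_Rfun_lt hτs.le hτs hτ hne.symm
    have h0 : m 0 = (τs + τ) / 2 := by simp only [hm]; ring
    rw [hL, h0]
    linarith
  have hgrow : ∀ n, L * (1 / 2) ^ n ≤ Real.log (Rfun τs (m n)) - Real.log (Rfun τs τs) := by
    intro n
    induction n with
    | zero => simp [hL]
    | succ n ih =>
      have h := log_Rfun_lt hτs.le hτs (hmpos n) (hmne n)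
      rw [hmsucc, pow_succ]
      linarith
  set K := 4 * (τs + τ) ^ 2 * (1 + (τs + τ) ^ 2) * (τ - τs) ^ 2 with hK
  have hbound : ∀ n : ℕ, Rfun τs τs * L ≤ K * (1 / 2) ^ n := fun n => by
    have hlow : Rfun τs τs * (1 + L * (1 / 2) ^ n) ≤ Rfun τs (m n) := by
      have h := Real.add_one_le_exp (L * (1 / 2) ^ n)
      have h' := Real.exp_le_exp.2 (hgrow n)
      rw [Real.exp_sub, Real.exp_log (Rfun_pos τs (hmpos n)), Real.exp_log hpos] at h'
      have h'' := h.trans h'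
      rw [le_div_iff₀ hpos] at h''
      linarith
    have hup : Rfun τs (m n) ≤ Rfun τs τs + K * ((1 / 2) ^ n * (1 / 2) ^ n) := by
      have h2 : 4 * m n ^ 2 * (1 + m n ^ 2) * (τs - m n) ^ 2 ≤
          4 * (τs + τ) ^ 2 * (1 + (τs + τ) ^ 2) * ((τ - τs) ^ 2 * ((1 / 2) ^ n * (1 / 2) ^ n)) := by
        have h3 : m n ^ 2 ≤ (τs + τ) ^ 2 := pow_le_pow_left₀ (hmpos n).le (hmle n) 2
        have h4 : (τs - m n) ^ 2 ≤ (τ - τs) ^ 2 * ((1 / 2) ^ n * (1 / 2) ^ n) := by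
          have h5 : (τs - m n) ^ 2 = (τ - τs) ^ 2 * ((1 / 2) ^ n * (1 / 2) ^ n) / 4 := by
            simp only [hm]; ring
          rw [h5]
          exact div_le_self (by positivity) (by norm_num)
        gcongr
      have h6 := hmax (m n) (hmpos n).le
      have h7 : Gfun τs = Rfun τs τs := rfl
      have h8 := Rfun_le τs (m n)
      rw [hK]
      linarith
    refine le_of_mul_le_mul_right ?_ (hp0 n)
    linarith
  have hlim : Filter.Tendsto (fun n : ℕ => K * (1 / 2) ^ n) Filter.atTop (nhds (K * 0)) :=
    (tendsto_pow_atTop_nhds_zero_of_lt_one (by norm_num) (by norm_num)).const_mul K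
  have hfin := ge_of_tendsto' hlim hbound
  rw [mul_zero] at hfin
  exact absurd hfin (not_le.2 (mul_pos hpos hLpos))
end

section
/- Let F : ℝ → ℝ be concave and let G : [0,∞) → ℝ satisfy F(x) − F(y) = G(x − y) for all real x ≥ y. Then there exist constants a and b such that F(x) = a·x + b for all x ∈ ℝ and G(x) = a·x for all x ≥ 0. Conversely, if F(x) = a·x + b and G(x) = a·x, then F(x) − F(y) = G(x − y) holds for all x ≥ y. -/
/-- A continuous function on `ℝ` whose increments depend only on the step is affine. -/
theorem Continuous.eq_mul_add_of_increment_eq {F : ℝ → ℝ} (hF : Continuous F)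
    (h : ∀ x y, F (x + y) - F y = F x - F 0) (x : ℝ) :
    F x = (F 1 - F 0) * x + F 0 := by
  let φ : ℝ →+ ℝ := AddMonoidHom.mk' (fun x => F x - F 0) fun x y => by linarith [h x y]
  have hφ : Continuous φ := hF.sub continuous_const
  have hx : F x - F 0 = x * (F 1 - F 0) := by
    simpa [φ] using map_real_smul φ hφ x 1
  linarith

theorem stmt17 (F G : ℝ → ℝ) :
    ((ConcaveOn ℝ Set.univ F ∧ ∀ x y : ℝ, y ≤ x → F x - F y = G (x - y)) →
      ∃ a b : ℝ, (∀ x : ℝ, F x = a * x + b) ∧ ∀ x : ℝ, 0 ≤ x → G x = a * x)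
    ∧ ∀ a b : ℝ, (∀ x : ℝ, F x = a * x + b) → (∀ x : ℝ, 0 ≤ x → G x = a * x) →
        ∀ x y : ℝ, y ≤ x → F x - F y = G (x - y) := by
  refine ⟨fun ⟨hF, hG⟩ => ?_, fun a b hF hG x y hxy => ?_⟩
  · have hcont : Continuous F :=
      continuousOn_univ.mp (hF.continuousOn isOpen_univ)
    have hincr : ∀ x y, F (x + y) - F y = F x - F 0 := fun x y => by
      rcases le_total 0 x with hx | hx
      · rw [hG _ _ (by linarith), hG _ _ hx]
        simp
      · have h₁ := hG y (x + y) (by linarith)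
        have h₂ := hG 0 x hx
        rw [show y - (x + y) = 0 - x by ring] at h₁
        linarith
    have haff := hcont.eq_mul_add_of_increment_eq hincr
    refine ⟨F 1 - F 0, F 0, haff, fun x hx => ?_⟩
    have hGx := hG x 0 hx
    rw [sub_zero] at hGx
    linarith [haff x]
  · rw [hF, hF, hG _ (sub_nonneg.mpr hxy)]
    ring
end

section
/- Let F : [0,1] → ℝ be concave and let G : [0,∞) → ℝ satisfy F(x) − F(y) = G(x − y) for all 0 ≤ y ≤ x ≤ 1. Then there exist constants a and b such that F(x) = a·x + b for all x ∈ [0,1] and G(x) = a·x for all x ∈ [0,1]. -/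
/-- A concave function on `[0,1]` lies above its chord. -/
lemma ConcaveOn.chord_le_unitInterval {F : ℝ → ℝ} (hF : ConcaveOn ℝ (Set.Icc (0:ℝ) 1) F)
    {x : ℝ} (hx : x ∈ Set.Icc (0:ℝ) 1) : (F 1 - F 0) * x + F 0 ≤ F x := by
  have h := hF.2 (x := 0) (y := 1) (by simp) (by simp) (sub_nonneg.2 hx.2) hx.1
    (sub_add_cancel 1 x)
  simp only [smul_eq_mul, mul_zero, mul_one, zero_add] at h
  linarith

theorem stmt18 (F G : ℝ → ℝ)
    (hF : ConcaveOn ℝ (Set.Icc (0:ℝ) 1) F)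
    (hFG : ∀ x y : ℝ, 0 ≤ y → y ≤ x → x ≤ 1 → F x - F y = G (x - y)) :
    ∃ a b : ℝ, (∀ x ∈ Set.Icc (0:ℝ) 1, F x = a * x + b)
      ∧ ∀ x ∈ Set.Icc (0:ℝ) 1, G x = a * x := by
  have hG : ∀ x ∈ Set.Icc (0:ℝ) 1, F x - F 0 = G x := fun x hx => by
    simpa using hFG x 0 le_rfl hx.1 hx.2
  have hF_affine : ∀ x ∈ Set.Icc (0:ℝ) 1, F x = (F 1 - F 0) * x + F 0 := by
    intro x hx
    have hx' : 1 - x ∈ Set.Icc (0:ℝ) 1 := ⟨by linarith [hx.2], by linarith [hx.1]⟩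
    have h_symm : F 1 - F (1 - x) = G x := by
      simpa using hFG 1 (1 - x) hx'.1 hx'.2 le_rfl
    linarith [hG x hx, hF.chord_le_unitInterval hx, hF.chord_le_unitInterval hx']
  exact ⟨F 1 - F 0, F 0, hF_affine, fun x hx => by linarith [hG x hx, hF_affine x hx]⟩
end

section
/- Let F : ℝ → ℝ be concave, let G : [0,∞) → ℝ, and let A > 0 and B ∈ ℝ be constants such that F(x) − F(y) = A·G(x − y) + B for all real x ≥ y. Then there exist constants a and b such that F(x) = a·x + b for all x ∈ ℝ and G(x) = (a/A)·x − B/A for all x ≥ 0. Conversely, these affine forms satisfy the stated identity for all x ≥ y. -/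
theorem eq_mul_add_of_concaveOn_of_map_add {F : ℝ → ℝ} (hF : ConcaveOn ℝ Set.univ F)
    (hadd : ∀ x y, F (x + y) - F x = F y - F 0) (x : ℝ) :
    F x = (F 1 - F 0) * x + F 0 := by
  have hcont : Continuous F := continuousOn_univ.mp (hF.continuousOn isOpen_univ)
  let φ : ℝ →+ ℝ :=
    { toFun := fun x => F x - F 0
      map_zero' := sub_self _
      map_add' := fun x y => by linarith [hadd x y] }
  have hφ : Continuous φ := hcont.sub continuous_const
  have h : F (x • (1 : ℝ)) - F 0 = x • (F 1 - F 0) := map_real_smul φ hφ x 1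
  simp only [smul_eq_mul, mul_one] at h
  linarith

theorem sub_eq_sub_zero_of_sub_eq {F H : ℝ → ℝ} (h : ∀ x y, y ≤ x → F x - F y = H (x - y))
    (x y : ℝ) : F (x + y) - F x = F y - F 0 := by
  rcases le_total 0 y with hy | hy
  · have h₁ := h (x + y) x (by linarith)
    have h₂ := h y 0 hy
    rw [add_sub_cancel_left] at h₁
    rw [sub_zero] at h₂
    linarith
  · have h₁ := h x (x + y) (by linarith)
    have h₂ := h 0 y hy
    rw [sub_add_cancel_left] at h₁
    rw [zero_sub] at h₂
    linarith

theorem stmt19 (F G : ℝ → ℝ) (A B : ℝ) (hA : 0 < A) :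
    ((ConcaveOn ℝ Set.univ F ∧ ∀ x y : ℝ, y ≤ x → F x - F y = A * G (x - y) + B) →
      ∃ a b : ℝ, (∀ x : ℝ, F x = a * x + b)
        ∧ ∀ x : ℝ, 0 ≤ x → G x = (a / A) * x - B / A)
    ∧ ∀ a b : ℝ, (∀ x : ℝ, F x = a * x + b) →
        (∀ x : ℝ, 0 ≤ x → G x = (a / A) * x - B / A) →
        ∀ x y : ℝ, y ≤ x → F x - F y = A * G (x - y) + B := by
  constructor
  · rintro ⟨hF, h⟩
    have hlin := eq_mul_add_of_concaveOn_of_map_add hF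
      (sub_eq_sub_zero_of_sub_eq (H := fun t => A * G t + B) h)
    refine ⟨F 1 - F 0, F 0, hlin, fun x hx => ?_⟩
    have h₁ := h x 0 hx
    rw [sub_zero] at h₁
    have h₂ := hlin x
    field_simp
    linarith
  · intro a b hF hG x y hxy
    rw [hF x, hF y, hG (x - y) (sub_nonneg.mpr hxy)]
    field_simp
    ring
end
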